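/- Fix real numbers α>0 and σ>0. For each n∈ℕ set ξ_n^{(ml)} = (1/√n)·E[ min_{x ∈ {−1/√n, 1/√n}^n} ‖A(x_sol − x) + σ v‖₂ ]. Then liminf_{n→∞} ξ_n^{(ml)} ≥ inf_{c1 ∈ [−1,1]} F(c1), where F(c1) = √α·√(2−2c1+σ²) − √(2/π)·e^{−(erfinv(c1))²} for c1 ∈ (−1,1) and F(±1) = √α·√(2∓2+σ²) (i.e. the exponential term is interpreted as its limit 0 at c1 = ±1). -/

import Mathlib

open MeasureTheory ProbabilityTheory Filter Real

/-- The error function `erf(x) = (2/√π) ∫₀ˣ e^{-t²} dt`. -/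
noncomputable def erf (x : ℝ) : ℝ := (2 / Real.sqrt π) * ∫ t in (0:ℝ)..x, Real.exp (-t^2)

/-- The standard Gaussian measure on `I → ℝ`. -/
noncomputable abbrev gaussPi (I : Type*) [Fintype I] : Measure (I → ℝ) :=
  Measure.pi fun _ => gaussianReal 0 1

instance isNegInvariant_gaussianReal : (gaussianReal 0 1).IsNegInvariant where
  neg_eq_self := by
    have h := gaussianReal_map_neg (μ := 0) (v := 1)
    rw [neg_zero] at h
    exact h

lemma hasDerivAt_gaussianPDFReal (x : ℝ) :
    HasDerivAt (gaussianPDFReal 0 1) (-x * gaussianPDFReal 0 1 x) x := by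
  have h : HasDerivAt (fun x : ℝ => (√(2 * π * (1 : NNReal)))⁻¹ *
      rexp (-(x - 0) ^ 2 / (2 * (1 : NNReal)))) _ x :=
    ((((((hasDerivAt_id x).sub_const 0).pow 2).neg).div_const (2 * (1 : NNReal))).exp).const_mul _
  rw [gaussianPDFReal_def]
  refine h.congr_deriv ?_
  simp
  ring

lemma integrable_id_gaussianReal : Integrable (fun x : ℝ => x) (gaussianReal 0 1) :=
  (memLp_id_gaussianReal (μ := 0) (v := 1) 1).integrable le_rfl

lemma integrable_gaussianReal_iff {f : ℝ → ℝ} :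
    Integrable f (gaussianReal 0 1) ↔ Integrable (fun x => gaussianPDFReal 0 1 x * f x) := by
  rw [gaussianReal_of_var_ne_zero _ one_ne_zero,
    integrable_withDensity_iff_integrable_smul₀' (by fun_prop)
      (ae_of_all _ fun _ => gaussianPDF_lt_top)]
  simp [toReal_gaussianPDF]

/-- Gaussian integration by parts in dimension one. -/
lemma integral_id_mul_gaussianReal {φ φ' : ℝ → ℝ} {C : ℝ} (hφ : ∀ x, HasDerivAt φ (φ' x) x)
    (hC : ∀ x, |φ x| ≤ C) (hC' : ∀ x, |φ' x| ≤ C) :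
    ∫ x, x * φ x ∂gaussianReal 0 1 = ∫ x, φ' x ∂gaussianReal 0 1 := by
  have hc : Continuous φ := continuous_iff_continuousAt.2 fun x => (hφ x).continuousAt
  have hm' : Measurable φ' := by
    have : φ' = deriv φ := funext fun x => (hφ x).deriv.symm
    rw [this]; exact measurable_deriv φ
  have i1 : Integrable φ (gaussianReal 0 1) :=
    .of_bound hc.aestronglyMeasurable C (ae_of_all _ hC)
  have i2 : Integrable φ' (gaussianReal 0 1) :=
    .of_bound hm'.aestronglyMeasurable C (ae_of_all _ hC')
  have i3 : Integrable (fun x => x * φ x) (gaussianReal 0 1) :=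
    integrable_id_gaussianReal.mul_bdd (c := C) hc.aestronglyMeasurable (ae_of_all _ hC)
  rw [integrable_gaussianReal_iff] at i1 i2 i3
  rw [integral_gaussianReal_eq_integral_smul one_ne_zero,
    integral_gaussianReal_eq_integral_smul one_ne_zero]
  have key := integral_mul_deriv_eq_deriv_mul_of_integrable (u := φ) (u' := φ')
    (v := gaussianPDFReal 0 1) (v' := fun x => -x * gaussianPDFReal 0 1 x)
    (fun x _ => hφ x) (fun x _ => hasDerivAt_gaussianPDFReal x)
    (i3.neg.congr (ae_of_all _ fun x => by simp only [Pi.neg_apply, Pi.mul_apply]; ring))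
    (i2.congr (ae_of_all _ fun x => by simp only [Pi.mul_apply]; ring))
    (i1.congr (ae_of_all _ fun x => by simp only [Pi.mul_apply]; ring))
  simp only [smul_eq_mul]
  rw [← neg_inj, ← integral_neg]
  calc _ = ∫ x, φ x * (-x * gaussianPDFReal 0 1 x) := by congr 1; ext x; ring
    _ = _ := key
    _ = _ := by congr 2; ext x; ring

/-- Resampling one coordinate preserves the product measure. -/
lemma measurePreserving_update_gaussPi {I : Type*} [Fintype I] [DecidableEq I] (i : I) :
    MeasurePreserving (fun p : (I → ℝ) × ℝ => Function.update p.1 i p.2)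
      ((gaussPi I).prod (gaussianReal 0 1)) (gaussPi I) := by
  have hm : Measurable (fun p : (I → ℝ) × ℝ => Function.update p.1 i p.2) := by
    refine measurable_pi_lambda _ fun j => ?_
    by_cases h : j = i
    · subst h; simpa using measurable_snd
    · simp only [Function.update_of_ne h]; fun_prop
  refine ⟨hm, ?_⟩
  symm
  refine Measure.pi_eq fun s hs => ?_
  rw [Measure.map_apply hm (.univ_pi hs)]
  have : (fun p : (I → ℝ) × ℝ => Function.update p.1 i p.2) ⁻¹' (Set.univ.pi s) =
      (Set.univ.pi (Function.update s i Set.univ)) ×ˢ s i := by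
    ext p
    simp only [Set.mem_preimage, Set.mem_pi, Set.mem_univ, true_imp_iff, Set.mem_prod]
    constructor
    · intro h
      refine ⟨fun j => ?_, by simpa using h i⟩
      by_cases hj : j = i
      · subst hj; simp
      · simpa [hj] using h j
    · rintro ⟨h1, h2⟩ j
      by_cases hj : j = i
      · subst hj; simpa using h2
      · simpa [hj] using h1 j
  rw [this, Measure.prod_prod, Measure.pi_pi,
    ← Finset.mul_prod_erase Finset.univ _ (Finset.mem_univ i),
    ← Finset.mul_prod_erase Finset.univ (fun j => gaussianReal 0 1 (s j)) (Finset.mem_univ i)]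
  simp only [Function.update_self, measure_univ, one_mul]
  rw [mul_comm]
  congr 1
  refine Finset.prod_congr rfl fun j hj => ?_
  rw [Function.update_of_ne (Finset.ne_of_mem_erase hj)]

lemma integrable_eval_gaussPi {I : Type*} [Fintype I] (i : I) :
    Integrable (fun x : I → ℝ => x i) (gaussPi I) :=
  (measurePreserving_eval (fun _ : I => gaussianReal 0 1) i).integrable_comp_of_integrable
    integrable_id_gaussianReal

/-- Gaussian integration by parts for a coordinate of a standard Gaussian vector. -/
lemma integral_eval_mul_gaussPi {I : Type*} [Fintype I] [DecidableEq I] (i : I)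
    {F F' : (I → ℝ) → ℝ} {C : ℝ} (hF : Measurable F) (hF' : Measurable F')
    (hd : ∀ x t, HasDerivAt (fun t => F (Function.update x i t)) (F' (Function.update x i t)) t)
    (hC : ∀ x, |F x| ≤ C) (hC' : ∀ x, |F' x| ≤ C) :
    ∫ x, x i * F x ∂gaussPi I = ∫ x, F' x ∂gaussPi I := by
  have hu := measurePreserving_update_gaussPi i
  have i1 : Integrable (fun x => x i * F x) (gaussPi I) :=
    (integrable_eval_gaussPi i).mul_bdd (c := C) hF.aestronglyMeasurable (ae_of_all _ hC)
  have i2 : Integrable F' (gaussPi I) :=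
    .of_bound hF'.aestronglyMeasurable C (ae_of_all _ hC')
  have e : ∀ G : (I → ℝ) → ℝ, Integrable G (gaussPi I) → ∫ x, G x ∂gaussPi I =
      ∫ x, ∫ t, G (Function.update x i t) ∂gaussianReal 0 1 ∂gaussPi I := by
    intro G hG
    have h := integral_map (f := G) hu.measurable.aemeasurable
      (by rw [hu.map_eq]; exact hG.aestronglyMeasurable)
    rw [hu.map_eq] at h
    rw [h]
    exact integral_prod _ (hu.integrable_comp_of_integrable hG)
  rw [e _ i1, e _ i2]
  congr 1
  ext x
  simp only [Function.update_self]
  exact integral_id_mul_gaussianReal (hd x) (fun t => hC _) (fun t => hC' _)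

lemma abs_le_of_hasFDerivAt {J : Type*} [Fintype J] {f : (J → ℝ) → ℝ}
    {f1 : J → (J → ℝ) → ℝ} {C : ℝ}
    (hf : ∀ z, HasFDerivAt f (∑ j, f1 j z • ContinuousLinearMap.proj (R := ℝ) j) z)
    (hC1 : ∀ j z, |f1 j z| ≤ C) (z : J → ℝ) : |f z| ≤ |f 0| + C * ∑ j, |z j| := by
  have hd : ∀ t : ℝ, HasDerivAt (fun t : ℝ => f (t • z)) (∑ j, f1 j (t • z) * z j) t := by
    intro t
    have h1 : HasDerivAt (fun t : ℝ => t • z) ((1 : ℝ) • z) t := (hasDerivAt_id t).smul_const z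
    convert! (hf (t • z)).comp_hasDerivAt t h1 using 1
    simp
  have h := norm_image_sub_le_of_norm_deriv_le_segment_01' (f := fun t : ℝ => f (t • z))
    (f' := fun t => ∑ j, f1 j (t • z) * z j) (C := C * ∑ j, |z j|)
    (fun t _ => (hd t).hasDerivWithinAt) (fun t _ => by
      rw [Finset.mul_sum]
      refine (Finset.abs_sum_le_sum_abs _ _).trans (Finset.sum_le_sum fun j _ => ?_)
      rw [abs_mul]
      exact mul_le_mul_of_nonneg_right (hC1 _ _) (abs_nonneg _))
  simp only [one_smul, zero_smul, Real.norm_eq_abs] at h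
  have := abs_sub_abs_le_abs_sub (f z) (f 0)
  linarith

lemma integrable_abs_eval_gaussPi {I : Type*} [Fintype I] (i : I) :
    Integrable (fun x : I → ℝ => |x i|) (gaussPi I) :=
  (integrable_eval_gaussPi i).abs

lemma integrable_comp_linear_gaussPi {I J : Type*} [Fintype I] [Fintype J] {f : (J → ℝ) → ℝ}
    (hf : Continuous f) {K C : ℝ} (hC : 0 ≤ C) (hb : ∀ z, |f z| ≤ K + C * ∑ j, |z j|)
    (M : J → I → ℝ) :
    Integrable (fun x : I → ℝ => f fun j => ∑ i, M j i * x i) (gaussPi I) := by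
  have hInt : Integrable (fun x : I → ℝ => K + C * ∑ j, ∑ i, |M j i| * |x i|) (gaussPi I) :=
    (integrable_const K).add ((integrable_finsetSum _ fun j _ => integrable_finsetSum _ fun i _ =>
      (integrable_abs_eval_gaussPi i).const_mul _).const_mul C)
  refine hInt.mono' (hf.comp (by fun_prop)).aestronglyMeasurable (ae_of_all _ fun x => ?_)
  refine (hb _).trans ?_
  gcongr with j _
  refine (Finset.abs_sum_le_sum_abs _ _).trans (le_of_eq ?_)
  simp only [abs_mul]

/-- Kahane's Gaussian comparison: interpolation between two centred Gaussian vectors `A ξ` and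
`B ξ` that are independent of each other. -/
theorem integral_comp_linear_gaussPi_le {I J : Type*} [Fintype I] [DecidableEq I] [Fintype J]
    (A B : J → I → ℝ) (hAB : ∀ j k, ∑ i, A j i * B k i = 0)
    {f : (J → ℝ) → ℝ} {f1 : J → (J → ℝ) → ℝ} {f2 : J → J → (J → ℝ) → ℝ} {C : ℝ} (hC : 0 ≤ C)
    (hf : ∀ z, HasFDerivAt f (∑ j, f1 j z • ContinuousLinearMap.proj (R := ℝ) j) z)
    (hf1 : ∀ j z, HasFDerivAt (f1 j) (∑ k, f2 j k z • ContinuousLinearMap.proj (R := ℝ) k) z)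
    (hf2 : ∀ j k, Measurable (f2 j k))
    (hC1 : ∀ j z, |f1 j z| ≤ C) (hC2 : ∀ j k z, |f2 j k z| ≤ C)
    (hpos : ∀ z, 0 ≤ ∑ j, ∑ k, f2 j k z * ∑ i, (A j i * A k i - B j i * B k i)) :
    ∫ x : I → ℝ, f (fun j => ∑ i, B j i * x i) ∂gaussPi I ≤
      ∫ x : I → ℝ, f (fun j => ∑ i, A j i * x i) ∂gaussPi I := by
  have hfc : Continuous f := continuous_iff_continuousAt.2 fun x => (hf x).continuousAt
  have hf1c : ∀ j, Continuous (f1 j) :=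
    fun j => continuous_iff_continuousAt.2 fun x => (hf1 j x).continuousAt
  set M : ℝ → J → I → ℝ := fun θ j i => cos θ * B j i + sin θ * A j i with hM
  set M' : ℝ → J → I → ℝ := fun θ j i => -sin θ * B j i + cos θ * A j i with hM'
  set Z : ℝ → (I → ℝ) → J → ℝ := fun θ x j => ∑ i, M θ j i * x i with hZ
  have hZc : ∀ θ, Continuous (Z θ) := fun θ => by fun_prop
  have hZd : ∀ x θ, HasDerivAt (fun θ => Z θ x) (fun j => ∑ i, M' θ j i * x i) θ := by
    intro x θ
    rw [hasDerivAt_pi]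
    intro j
    refine HasDerivAt.fun_sum fun i _ => HasDerivAt.mul_const ?_ _
    exact ((hasDerivAt_cos θ).mul_const _).add ((hasDerivAt_sin θ).mul_const _)
  have hInt : ∀ θ, Integrable (fun x => f (Z θ x)) (gaussPi I) := fun θ =>
    integrable_comp_linear_gaussPi hfc hC (abs_le_of_hasFDerivAt hf hC1) (M θ)
  have hder : ∀ θ, HasDerivAt (fun θ => ∫ x, f (Z θ x) ∂gaussPi I)
      (∫ x, ∑ j, f1 j (Z θ x) * ∑ i, M' θ j i * x i ∂gaussPi I) θ := by
    intro θ
    refine (hasDerivAt_integral_of_dominated_loc_of_deriv_le (s := Set.univ) (x₀ := θ)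
      (F := fun θ x => f (Z θ x)) (F' := fun θ x => ∑ j, f1 j (Z θ x) * ∑ i, M' θ j i * x i)
      (bound := fun x => ∑ j, C * ∑ i, (|B j i| + |A j i|) * |x i|)
      Filter.univ_mem (Eventually.of_forall fun θ => by fun_prop) (hInt θ)
      (by fun_prop) (ae_of_all _ fun x θ _ => ?_) ?_ (ae_of_all _ fun x θ _ => ?_)).2
    · refine (Finset.abs_sum_le_sum_abs _ _).trans (Finset.sum_le_sum fun j _ => ?_)
      rw [abs_mul]
      refine mul_le_mul (hC1 _ _) ?_ (abs_nonneg _) hC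
      refine (Finset.abs_sum_le_sum_abs _ _).trans (Finset.sum_le_sum fun i _ => ?_)
      rw [abs_mul]
      refine mul_le_mul_of_nonneg_right ?_ (abs_nonneg _)
      refine (abs_add_le _ _).trans ?_
      rw [abs_mul, abs_mul, abs_neg]
      exact add_le_add (mul_le_of_le_one_left (abs_nonneg _) (abs_sin_le_one _))
        (mul_le_of_le_one_left (abs_nonneg _) (abs_cos_le_one _))
    · exact integrable_finsetSum _ fun j _ => (integrable_finsetSum _ fun i _ =>
        (integrable_abs_eval_gaussPi i).const_mul _).const_mul C
    · convert! (hf (Z θ x)).comp_hasDerivAt θ (hZd x θ) using 1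
      simp
  have hZu : ∀ θ i x t, HasDerivAt (fun t => Z θ (Function.update x i t)) (fun j => M θ j i) t := by
    intro θ i x t
    rw [hasDerivAt_pi]
    intro j
    have h := (hasDerivAt_pi (φ := fun t => Function.update x i t)
      (φ' := Pi.single i (1 : ℝ))).1 (hasDerivAt_update x i t)
    have h2 := HasDerivAt.fun_sum (u := Finset.univ) fun k _ => (h k).const_mul (M θ j k)
    convert! h2 using 1
    simp [Pi.single_apply]
  have hstein : ∀ θ j i, ∫ x, x i * f1 j (Z θ x) ∂gaussPi I =
      ∫ x, ∑ k, f2 j k (Z θ x) * M θ k i ∂gaussPi I := by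
    intro θ j i
    refine integral_eval_mul_gaussPi (C := C + ∑ k, C * |M θ k i|) i (by fun_prop)
      (Finset.measurable_sum _ fun k _ => ((hf2 j k).comp (hZc θ).measurable).mul_const _)
      (fun x t => ?_) (fun x => ?_) fun x => ?_
    · convert! (hf1 j (Z θ (Function.update x i t))).comp_hasDerivAt t (hZu θ i x t) using 1
      simp
    · have : 0 ≤ ∑ k, C * |M θ k i| := by positivity
      linarith [hC1 j (Z θ x)]
    · have : |∑ k, f2 j k (Z θ x) * M θ k i| ≤ ∑ k, C * |M θ k i| := by
        refine (Finset.abs_sum_le_sum_abs _ _).trans (Finset.sum_le_sum fun k _ => ?_)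
        rw [abs_mul]
        exact mul_le_mul_of_nonneg_right (hC2 _ _ _) (abs_nonneg _)
      linarith
  have hif2 : ∀ θ j k, Integrable (fun x => f2 j k (Z θ x)) (gaussPi I) := fun θ j k =>
    .of_bound ((hf2 j k).comp (hZc θ).measurable).aestronglyMeasurable C (ae_of_all _ fun x => hC2 _ _ _)
  have hif1 : ∀ θ j i, Integrable (fun x => x i * f1 j (Z θ x)) (gaussPi I) := fun θ j i =>
    (integrable_eval_gaussPi i).mul_bdd (c := C) (by fun_prop) (ae_of_all _ fun x => hC1 _ _)
  have hval : ∀ θ, ∫ x, ∑ j, f1 j (Z θ x) * ∑ i, M' θ j i * x i ∂gaussPi I =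
      ∫ x, sin θ * cos θ * ∑ j, ∑ k, f2 j k (Z θ x) * ∑ i, (A j i * A k i - B j i * B k i)
        ∂gaussPi I := by
    intro θ
    calc _ = ∫ x, ∑ j, ∑ i, M' θ j i * (x i * f1 j (Z θ x)) ∂gaussPi I := by
          congr 1; ext x
          refine Finset.sum_congr rfl fun j _ => ?_
          rw [Finset.mul_sum]
          exact Finset.sum_congr rfl fun i _ => by ring
      _ = ∑ j, ∑ i, M' θ j i * ∫ x, ∑ k, f2 j k (Z θ x) * M θ k i ∂gaussPi I := by
          rw [integral_finsetSum _ fun j _ => integrable_finsetSum _ fun i _ =>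
            (hif1 θ j i).const_mul _]
          refine Finset.sum_congr rfl fun j _ => ?_
          rw [integral_finsetSum _ fun i _ => (hif1 θ j i).const_mul _]
          refine Finset.sum_congr rfl fun i _ => ?_
          rw [integral_const_mul, hstein]
      _ = ∫ x, ∑ j, ∑ i, M' θ j i * ∑ k, f2 j k (Z θ x) * M θ k i ∂gaussPi I := by
          have h0 : ∀ j i, Integrable (fun x => M' θ j i * ∑ k, f2 j k (Z θ x) * M θ k i)
            (gaussPi I) := fun j i => (integrable_finsetSum _ fun k _ =>
              (hif2 θ j k).mul_const _).const_mul _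
          rw [integral_finsetSum _ fun j _ => integrable_finsetSum _ fun i _ => h0 j i]
          refine Finset.sum_congr rfl fun j _ => ?_
          rw [integral_finsetSum _ fun i _ => h0 j i]
          refine Finset.sum_congr rfl fun i _ => ?_
          rw [integral_const_mul]
      _ = _ := by
          congr 1; ext x
          rw [Finset.mul_sum]
          refine Finset.sum_congr rfl fun j _ => ?_
          simp_rw [Finset.mul_sum]
          rw [Finset.sum_comm]
          refine Finset.sum_congr rfl fun k _ => ?_
          have e1 := hAB j k
          have e2 := hAB k j
          have : ∑ i, M' θ j i * M θ k i =
              sin θ * cos θ * ∑ i, (A j i * A k i - B j i * B k i) := by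
            have : ∀ i, M' θ j i * M θ k i =
                sin θ * cos θ * (A j i * A k i - B j i * B k i) + cos θ * cos θ * (A j i * B k i)
                - sin θ * sin θ * (A k i * B j i) := fun i => by simp only [hM, hM']; ring
            simp_rw [this, Finset.sum_sub_distrib, Finset.sum_add_distrib, ← Finset.mul_sum]
            rw [e1, e2, Finset.sum_sub_distrib]; ring
          calc _ = f2 j k (Z θ x) * ∑ i, M' θ j i * M θ k i := by
                rw [Finset.mul_sum]; exact Finset.sum_congr rfl fun i _ => by ring
            _ = _ := by rw [this, ← Finset.mul_sum, ← Finset.mul_sum]; ring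
  have hmono : MonotoneOn (fun θ => ∫ x, f (Z θ x) ∂gaussPi I) (Set.Icc 0 (π / 2)) := by
    refine monotoneOn_of_deriv_nonneg (convex_Icc _ _)
      (fun θ _ => (hder θ).continuousAt.continuousWithinAt)
      (fun θ _ => (hder θ).differentiableAt.differentiableWithinAt) fun θ hθ => ?_
    rw [interior_Icc] at hθ
    rw [(hder θ).deriv, hval θ]
    refine integral_nonneg fun x => mul_nonneg (mul_nonneg ?_ ?_) (hpos _)
    · exact sin_nonneg_of_nonneg_of_le_pi hθ.1.le (by linarith [hθ.2, pi_pos])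
    · exact cos_nonneg_of_neg_pi_div_two_le_of_le (by linarith [hθ.1, pi_pos]) hθ.2.le
  have h := hmono (Set.left_mem_Icc.2 (by positivity)) (Set.right_mem_Icc.2 (by positivity))
    (by positivity : (0 : ℝ) ≤ π / 2)
  simpa [hZ, hM] using h

/-- `f` is differentiable at `z` with partial derivatives `g`. -/
def HasPartials {J : Type*} [Fintype J] (f : (J → ℝ) → ℝ) (g : J → ℝ) (z : J → ℝ) : Prop :=
  HasFDerivAt f (∑ j, g j • ContinuousLinearMap.proj (R := ℝ) (φ := fun _ : J => ℝ) j) z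

namespace HasPartials

variable {J : Type*} [Fintype J] {f₁ f₂ : (J → ℝ) → ℝ} {g₁ g₂ g : J → ℝ} {z : J → ℝ}

lemma congr_partials (h : HasPartials f₁ g₁ z) (e : ∀ j, g₁ j = g j) : HasPartials f₁ g z := by
  rwa [← funext e]

lemma eval [DecidableEq J] (j : J) (z : J → ℝ) :
    HasPartials (fun z => z j) (fun k => if k = j then 1 else 0) z := by
  have h := (ContinuousLinearMap.proj (R := ℝ) (φ := fun _ : J => ℝ) j).hasFDerivAt (x := z)
  refine HasFDerivAt.congr_fderiv h ?_
  ext v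
  simp

lemma const (c : ℝ) (z : J → ℝ) : HasPartials (fun _ => c) (fun _ => 0) z :=
  (hasFDerivAt_const c z).congr_fderiv (by ext v; simp)

lemma comp_real {φ : ℝ → ℝ} {φ' : ℝ} (hφ : HasDerivAt φ φ' (f₁ z)) (h : HasPartials f₁ g₁ z) :
    HasPartials (fun z => φ (f₁ z)) (fun j => φ' * g₁ j) z :=
  (hφ.comp_hasFDerivAt z h).congr_fderiv (by ext v; simp [Finset.mul_sum, mul_assoc])

lemma add (h₁ : HasPartials f₁ g₁ z) (h₂ : HasPartials f₂ g₂ z) :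
    HasPartials (fun z => f₁ z + f₂ z) (fun j => g₁ j + g₂ j) z :=
  (HasFDerivAt.add h₁ h₂).congr_fderiv (by ext v; simp [Finset.sum_add_distrib, add_mul])

lemma mul (h₁ : HasPartials f₁ g₁ z) (h₂ : HasPartials f₂ g₂ z) :
    HasPartials (fun z => f₁ z * f₂ z) (fun j => f₁ z * g₂ j + f₂ z * g₁ j) z :=
  (HasFDerivAt.mul h₁ h₂).congr_fderiv (by
    ext v; simp [Finset.sum_add_distrib, add_mul, Finset.mul_sum, mul_assoc])

lemma sum {W : Type*} [Fintype W] {f : W → (J → ℝ) → ℝ} {g : W → J → ℝ}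
    (h : ∀ w, HasPartials (f w) (g w) z) :
    HasPartials (fun z => ∑ w, f w z) (fun j => ∑ w, g w j) z :=
  (HasFDerivAt.fun_sum fun w _ => h w).congr_fderiv (by
    ext v
    simp only [_root_.sum_apply, _root_.smul_apply,
      ContinuousLinearMap.proj_apply, smul_eq_mul, Finset.sum_mul]
    exact Finset.sum_comm)

end HasPartials

section SoftMin

variable {W k : Type*} [Fintype k] (ε β : ℝ)

/-- The smoothed Euclidean norm of the block `w` of `z`. -/
noncomputable def blockNorm (w : W) (z : W × Option k → ℝ) : ℝ := √(ε ^ 2 + ∑ i, z (w, some i) ^ 2)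

/-- The smoothed norm of the block `w` plus its scalar coordinate. -/
noncomputable def blockEnergy (w : W) (z : W × Option k → ℝ) : ℝ :=
  blockNorm ε w z + z (w, none)

/-- The partial derivatives of `blockEnergy`. -/
noncomputable def blockGrad (j : W × Option k) (z : W × Option k → ℝ) : ℝ :=
  match j with
  | (_, none) => 1
  | (w, some i) => z (w, some i) / blockNorm ε w z

/-- The partial derivatives of `blockGrad`. -/
noncomputable def blockHess [DecidableEq W] [DecidableEq k] (j l : W × Option k)
    (z : W × Option k → ℝ) : ℝ :=
  match j, l with
  | (w, some i), (w', some i') => if w' = w then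
      (if i' = i then 1 else 0) / blockNorm ε w z
        - z (w, some i) * z (w, some i') / blockNorm ε w z ^ 3 else 0
  | _, _ => 0

variable {ε β}

lemma blockNorm_pos (hε : 0 < ε) (w : W) (z : W × Option k → ℝ) : 0 < blockNorm ε w z :=
  sqrt_pos.2 (by positivity)

lemma le_blockNorm (w : W) (z : W × Option k → ℝ) : ε ≤ blockNorm ε w z :=
  le_sqrt_of_sq_le (le_add_of_nonneg_right (by positivity))

lemma abs_le_blockNorm (w : W) (i : k) (z : W × Option k → ℝ) :
    |z (w, some i)| ≤ blockNorm ε w z := by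
  refine abs_le_sqrt ?_
  have := Finset.single_le_sum (f := fun i => z (w, some i) ^ 2) (fun i _ => sq_nonneg _)
    (Finset.mem_univ i)
  nlinarith [sq_nonneg ε]

@[fun_prop]
lemma continuous_blockNorm (w : W) : Continuous (blockNorm (k := k) ε w) := by
  unfold blockNorm; fun_prop

@[fun_prop]
lemma continuous_blockEnergy (w : W) : Continuous (blockEnergy (k := k) ε w) := by
  unfold blockEnergy; fun_prop

lemma continuous_blockGrad (hε : 0 < ε) (j : W × Option k) : Continuous (blockGrad ε j) := by
  rcases j with ⟨w, _ | i⟩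
  · exact continuous_const
  · exact (continuous_apply _).div (by fun_prop) fun z => (blockNorm_pos hε w z).ne'

lemma abs_blockGrad_le (hε : 0 < ε) (j : W × Option k) (z : W × Option k → ℝ) :
    |blockGrad ε j z| ≤ 1 := by
  rcases j with ⟨w, _ | i⟩
  · simp [blockGrad]
  · simp only [blockGrad]
    rw [abs_div, abs_of_pos (blockNorm_pos hε w z)]
    exact div_le_one_of_le₀ (abs_le_blockNorm _ _ _) (blockNorm_pos hε w z).le

lemma abs_blockHess_le [DecidableEq W] [DecidableEq k] (hε : 0 < ε) (j l : W × Option k)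
    (z : W × Option k → ℝ) : |blockHess ε j l z| ≤ 2 / ε := by
  have h0 : 0 ≤ 2 / ε := by positivity
  rcases j with ⟨w, _ | i⟩
  · simpa [blockHess] using h0
  rcases l with ⟨w', _ | i'⟩
  · simpa [blockHess] using h0
  simp only [blockHess]
  split_ifs with h1 h2
  all_goals try simpa using h0
  all_goals
    have hR := blockNorm_pos hε w z
    have hi := abs_le_blockNorm (ε := ε) w i z
    have hi' := abs_le_blockNorm (ε := ε) w i' z
    have e1 : 1 / blockNorm ε w z ≤ 1 / ε := one_div_le_one_div_of_le hε (le_blockNorm w z)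
    have e2 : |z (w, some i) * z (w, some i') / blockNorm ε w z ^ 3| ≤ 1 / ε := by
      refine le_trans ?_ e1
      rw [abs_div, abs_mul, abs_of_pos (pow_pos hR 3), div_le_div_iff₀ (by positivity) hR]
      nlinarith [mul_le_mul hi hi' (abs_nonneg _) hR.le]
    refine (abs_sub _ _).trans ?_
    have e3 : 2 / ε = 1 / ε + 1 / ε := by ring
    rw [e3]
    refine add_le_add ?_ e2
  · rwa [abs_of_pos (by positivity)]
  · simp; positivity

lemma measurable_blockHess [Countable W] [DecidableEq W] [DecidableEq k] (j l : W × Option k) :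
    Measurable (blockHess ε j l) := by
  rcases j with ⟨w, _ | i⟩
  · exact measurable_const
  rcases l with ⟨w', _ | i'⟩
  · exact measurable_const
  have := (continuous_blockNorm (k := k) (ε := ε) w).measurable
  change Measurable fun z => if w' = w then
      (if i' = i then 1 else 0) / blockNorm ε w z
        - z (w, some i) * z (w, some i') / blockNorm ε w z ^ 3 else 0
  split_ifs <;> fun_prop

lemma sum_blockGrad_mul_le_one (hε : 0 < ε) (w w' : W) (z : W × Option k → ℝ) :
    ∑ i, blockGrad ε (w, some i) z * blockGrad ε (w', some i) z ≤ 1 := by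
  have hR := blockNorm_pos hε w z
  have hR' := blockNorm_pos hε w' z
  have h := Real.sum_mul_le_sqrt_mul_sqrt Finset.univ (fun i : k => z (w, some i))
    fun i => z (w', some i)
  have h1 : √(∑ i : k, z (w, some i) ^ 2) ≤ blockNorm ε w z := sqrt_le_sqrt (by nlinarith [sq_nonneg ε])
  have h2 : √(∑ i : k, z (w', some i) ^ 2) ≤ blockNorm ε w' z :=
    sqrt_le_sqrt (by nlinarith [sq_nonneg ε])
  have : ∑ i, blockGrad ε (w, some i) z * blockGrad ε (w', some i) z =
      (∑ i, z (w, some i) * z (w', some i)) / (blockNorm ε w z * blockNorm ε w' z) := by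
    rw [Finset.sum_div]
    exact Finset.sum_congr rfl fun i _ => by simp only [blockGrad]; ring
  rw [this]
  exact div_le_one_of_le₀ (h.trans (mul_le_mul h1 h2 (sqrt_nonneg _) hR.le)) (by positivity)

variable [Fintype W]

variable (ε β) in
/-- The Gibbs weights of the blocks. -/
noncomputable def gibbs (w : W) (z : W × Option k → ℝ) : ℝ :=
  rexp (-β * blockEnergy ε w z) / ∑ w', rexp (-β * blockEnergy ε w' z)

variable (ε β) in
/-- The smoothed minimum of the block energies. -/
noncomputable def softMin (z : W × Option k → ℝ) : ℝ :=
  -β⁻¹ * log (∑ w, rexp (-β * blockEnergy ε w z))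

variable (ε β) in
/-- The second partial derivatives of `softMin`. -/
noncomputable def softMinHess [DecidableEq W] [DecidableEq k] (j l : W × Option k)
    (z : W × Option k → ℝ) : ℝ :=
  gibbs ε β j.1 z * blockHess ε j l z + blockGrad ε j z * (-β * gibbs ε β j.1 z *
    ((if l.1 = j.1 then blockGrad ε l z else 0) - gibbs ε β l.1 z * blockGrad ε l z))

lemma sum_exp_pos [Nonempty W] (z : W × Option k → ℝ) :
    0 < ∑ w, rexp (-β * blockEnergy ε w z) :=
  Finset.sum_pos (fun _ _ => exp_pos _) Finset.univ_nonempty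

lemma continuous_gibbs [Nonempty W] (w : W) : Continuous (gibbs (k := k) ε β w) := by
  unfold gibbs
  exact Continuous.div (by fun_prop) (by fun_prop) fun z => (sum_exp_pos z).ne'

lemma gibbs_nonneg (w : W) (z : W × Option k → ℝ) : 0 ≤ gibbs ε β w z := by
  unfold gibbs; positivity

lemma gibbs_le_one (w : W) (z : W × Option k → ℝ) : gibbs ε β w z ≤ 1 :=
  div_le_one_of_le₀ (Finset.single_le_sum (f := fun w => rexp (-β * blockEnergy ε w z))
    (fun _ _ => (exp_pos _).le) (Finset.mem_univ w)) (by positivity)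

lemma hasPartials_blockNorm [DecidableEq W] (hε : 0 < ε) (w : W) (z : W × Option k → ℝ) :
    HasPartials (blockNorm ε w)
      (fun j => if j.1 = w then j.2.elim 0 fun i => z (w, some i) / blockNorm ε w z else 0) z := by
  classical
  have h0 : ε ^ 2 + ∑ i, z (w, some i) ^ 2 ≠ 0 := by positivity
  have h := ((HasPartials.const (ε ^ 2) z).add (HasPartials.sum fun i : k =>
    (HasPartials.eval (w, some i) z).comp_real (φ := fun x => x ^ 2)
      (hasDerivAt_pow 2 _))).comp_real (hasDerivAt_sqrt h0)
  refine h.congr_partials fun ⟨w', a⟩ => ?_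
  have hb : √(ε ^ 2 + ∑ i, z (w, some i) ^ 2) = blockNorm ε w z := rfl
  have := (blockNorm_pos hε w z).ne'
  rw [hb]
  rcases a with _ | i
  · simp
  · by_cases hw : w' = w
    · subst hw
      simp
      field_simp
    · simp [hw]

lemma hasPartials_blockEnergy [DecidableEq W] (hε : 0 < ε) (w : W) (z : W × Option k → ℝ) :
    HasPartials (blockEnergy ε w) (fun j => if j.1 = w then blockGrad ε j z else 0) z := by
  classical
  refine ((hasPartials_blockNorm hε w z).add (HasPartials.eval (w, none) z)).congr_partials
    fun ⟨w', a⟩ => ?_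
  by_cases hw : w' = w
  · subst hw
    cases a <;> simp [blockGrad]
  · simp [hw]

lemma hasPartials_blockGrad [DecidableEq W] [DecidableEq k] (hε : 0 < ε) (j : W × Option k)
    (z : W × Option k → ℝ) :
    HasPartials (blockGrad ε j) (fun l => blockHess ε j l z) z := by
  rcases j with ⟨w, _ | i⟩
  · exact HasPartials.const 1 z
  · have hR := (blockNorm_pos hε w z).ne'
    have h := (HasPartials.eval (w, some i) z).mul
      ((hasPartials_blockNorm hε w z).comp_real (hasDerivAt_inv hR))
    refine h.congr_partials fun ⟨w', a⟩ => ?_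
    rcases a with _ | i'
    · simp [blockHess]
    · by_cases hw : w' = w
      · subst hw
        simp only [blockHess, Prod.mk.injEq, Option.some.injEq, true_and, if_true, Option.elim]
        field_simp
        ring
      · simp [hw, blockHess]

lemma hasPartials_sum_exp [DecidableEq W] (hε : 0 < ε) (z : W × Option k → ℝ) :
    HasPartials (fun z => ∑ w, rexp (-β * blockEnergy ε w z))
      (fun j => -β * rexp (-β * blockEnergy ε j.1 z) * blockGrad ε j z) z := by
  refine (HasPartials.sum fun w => (hasPartials_blockEnergy hε w z).comp_real
    (φ := fun x => rexp (-β * x)) (((hasDerivAt_id _).const_mul (-β)).exp)).congr_partials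
    fun j => ?_
  simp only [id, mul_ite, mul_zero, Finset.sum_ite_eq, Finset.mem_univ, if_true]
  ring

lemma hasPartials_softMin [DecidableEq W] [Nonempty W] (hε : 0 < ε) (hβ : 0 < β)
    (z : W × Option k → ℝ) :
    HasPartials (softMin ε β) (fun j => gibbs ε β j.1 z * blockGrad ε j z) z := by
  have hS := (sum_exp_pos (ε := ε) (β := β) z).ne'
  refine (HasPartials.comp_real (f₁ := fun z => ∑ w, rexp (-β * blockEnergy ε w z))
    (φ := fun x => -β⁻¹ * log x)
    ((hasDerivAt_log hS).const_mul (-β⁻¹)) (hasPartials_sum_exp hε z)).congr_partials fun j => ?_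
  unfold gibbs
  field_simp

lemma hasPartials_gibbs [DecidableEq W] [Nonempty W] (hε : 0 < ε)
    (w : W) (z : W × Option k → ℝ) :
    HasPartials (gibbs ε β w) (fun l => -β * gibbs ε β w z *
      ((if l.1 = w then blockGrad ε l z else 0) - gibbs ε β l.1 z * blockGrad ε l z)) z := by
  have hS := (sum_exp_pos (ε := ε) (β := β) z).ne'
  have h1 := (hasPartials_blockEnergy hε w z).comp_real
    (φ := fun x => rexp (-β * x)) (((hasDerivAt_id _).const_mul (-β)).exp)
  refine (h1.mul ((hasPartials_sum_exp hε z).comp_real (hasDerivAt_inv hS))).congr_partials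
    fun l => ?_
  simp only [gibbs, id]
  field_simp
  ring

lemma hasPartials_softMin_partial [DecidableEq W] [DecidableEq k] [Nonempty W] (hε : 0 < ε)
    (j : W × Option k) (z : W × Option k → ℝ) :
    HasPartials (fun z => gibbs ε β j.1 z * blockGrad ε j z)
      (fun l => softMinHess ε β j l z) z :=
  (hasPartials_gibbs hε j.1 z).mul (hasPartials_blockGrad hε j z)

lemma abs_softMinHess_le [DecidableEq W] [DecidableEq k] (hε : 0 < ε) (hβ : 0 < β)
    (j l : W × Option k) (z : W × Option k → ℝ) : |softMinHess ε β j l z| ≤ 2 / ε + 2 * β := by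
  unfold softMinHess
  have p0 := gibbs_nonneg (ε := ε) (β := β) j.1 z
  have p1 := gibbs_le_one (ε := ε) (β := β) j.1 z
  have q0 := gibbs_nonneg (ε := ε) (β := β) l.1 z
  have q1 := gibbs_le_one (ε := ε) (β := β) l.1 z
  have n1 := abs_blockGrad_le hε j z
  have n2 := abs_blockGrad_le hε l z
  refine (abs_add_le _ _).trans (add_le_add ?_ ?_)
  · rw [abs_mul, abs_of_nonneg p0]
    calc _ ≤ 1 * (2 / ε) := mul_le_mul p1 (abs_blockHess_le hε j l z) (abs_nonneg _) zero_le_one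
      _ = _ := one_mul _
  · have : |(if l.1 = j.1 then blockGrad ε l z else 0) - gibbs ε β l.1 z * blockGrad ε l z| ≤ 2 := by
      refine (abs_sub _ _).trans ?_
      have a1 : |if l.1 = j.1 then blockGrad ε l z else 0| ≤ 1 := by
        split_ifs
        · exact n2
        · simp
      have a2 : |gibbs ε β l.1 z * blockGrad ε l z| ≤ 1 := by
        rw [abs_mul, abs_of_nonneg q0]
        exact mul_le_one₀ q1 (abs_nonneg _) n2
      linarith
    rw [abs_mul, abs_mul, abs_mul, abs_neg, abs_of_pos hβ, abs_of_nonneg p0]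
    calc _ ≤ 1 * (β * 1 * 2) := by gcongr
      _ = _ := by ring

lemma measurable_softMinHess [DecidableEq W] [DecidableEq k] [Nonempty W] (hε : 0 < ε)
    (j l : W × Option k) : Measurable (softMinHess ε β j l) := by
  have h2 := fun j => (continuous_blockGrad (W := W) (k := k) hε j).measurable
  have h3 := measurable_blockHess (ε := ε) j l
  have h1 := (continuous_gibbs (k := k) (ε := ε) (β := β) j.1).measurable
  have h1' := (continuous_gibbs (k := k) (ε := ε) (β := β) l.1).measurable
  have h2' := h2 l
  have h2 := h2 j
  change Measurable fun z => gibbs ε β j.1 z * blockHess ε j l z +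
    blockGrad ε j z * (-β * gibbs ε β j.1 z *
    ((if l.1 = j.1 then blockGrad ε l z else 0) - gibbs ε β l.1 z * blockGrad ε l z))
  split_ifs <;> fun_prop

lemma softMinHess_of_ne [DecidableEq W] [DecidableEq k] {w w' : W} (h : w ≠ w') (a b : Option k)
    (z : W × Option k → ℝ) : softMinHess ε β (w, a) (w', b) z =
      β * gibbs ε β w z * gibbs ε β w' z * (blockGrad ε (w, a) z * blockGrad ε (w', b) z) := by
  have hb : blockHess ε (w, a) (w', b) z = 0 := by
    rcases a with _ | i <;> rcases b with _ | i' <;> simp [blockHess, h.symm]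
  simp only [softMinHess, hb, h.symm, if_false]
  ring

lemma softMin_le (hβ : 0 < β) (w : W) (z : W × Option k → ℝ) :
    softMin ε β z ≤ blockEnergy ε w z := by
  have h : -β * blockEnergy ε w z ≤ log (∑ w, rexp (-β * blockEnergy ε w z)) := by
    rw [← log_exp (-β * blockEnergy ε w z)]
    exact log_le_log (exp_pos _) (Finset.single_le_sum
      (f := fun w => rexp (-β * blockEnergy ε w z)) (fun _ _ => (exp_pos _).le) (Finset.mem_univ w))
  unfold softMin
  have := mul_le_mul_of_nonneg_left h (inv_pos.2 hβ).le
  have e : β⁻¹ * (-β * blockEnergy ε w z) = -blockEnergy ε w z := by field_simp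
  linarith

lemma le_softMin [Nonempty W] (hβ : 0 < β) {c : ℝ} {z : W × Option k → ℝ}
    (h : ∀ w, c ≤ blockEnergy ε w z) : c - β⁻¹ * log (Fintype.card W) ≤ softMin ε β z := by
  have h1 : ∑ w, rexp (-β * blockEnergy ε w z) ≤ Fintype.card W * rexp (-β * c) := by
    refine (Finset.sum_le_sum fun w _ => exp_le_exp.2
      (mul_le_mul_of_nonpos_left (h w) (neg_nonpos.2 hβ.le))).trans ?_
    simp
  have hc : (0 : ℝ) < Fintype.card W := by exact_mod_cast Fintype.card_pos
  have h2 := log_le_log (sum_exp_pos z) h1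
  rw [log_mul hc.ne' (exp_pos _).ne', log_exp] at h2
  have h3 := mul_le_mul_of_nonneg_left h2 (inv_pos.2 hβ).le
  have e : β⁻¹ * (log (Fintype.card W) + -β * c) = β⁻¹ * log (Fintype.card W) - c := by
    field_simp; ring
  unfold softMin
  linarith

end SoftMin

lemma integrable_ciInf {Ω W : Type*} [MeasurableSpace Ω] {μ : Measure Ω} [Fintype W] [Nonempty W]
    {f : W → Ω → ℝ} (hf : ∀ w, Integrable (f w) μ) : Integrable (fun x => ⨅ w, f w x) μ := by
  refine (integrable_finsetSum Finset.univ fun w _ => (hf w).abs).mono'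
    (AEMeasurable.iInf fun w => (hf w).aemeasurable).aestronglyMeasurable (ae_of_all _ fun x => ?_)
  obtain ⟨w, hw⟩ := exists_eq_ciInf_of_finite (f := fun w => f w x)
  rw [← hw]
  exact Finset.single_le_sum (f := fun w => |f w x|) (fun _ _ => abs_nonneg _) (Finset.mem_univ w)

lemma integrable_sqrt_sum_sq {Ω k : Type*} [MeasurableSpace Ω] {μ : Measure Ω} [Fintype k]
    {f : k → Ω → ℝ} (hf : ∀ i, Integrable (f i) μ) :
    Integrable (fun x => √(∑ i, f i x ^ 2)) μ := by
  have hm := fun i => (hf i).aestronglyMeasurable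
  refine (integrable_finsetSum Finset.univ fun i _ => (hf i).abs).mono'
    (by fun_prop) (ae_of_all _ fun x => ?_)
  rw [Real.norm_eq_abs, abs_of_nonneg (sqrt_nonneg _)]
  refine sqrt_le_iff.2 ⟨by positivity, ?_⟩
  refine le_trans (le_of_eq ?_)
    (Finset.sum_sq_le_sq_sum_of_nonneg (f := fun i => |f i x|) fun _ _ => abs_nonneg _)
  simp only [sq_abs]

section Gordon

variable {W k ι : Type*} [Fintype ι]

/-- Coefficients of the Gaussian process `(G v, ‖v‖ g)` in block form. -/
noncomputable def gordonA [DecidableEq k] (v : W → ι → ℝ) (j : W × Option k)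
    (i : Option k × Option ι) : ℝ :=
  if i.1 = j.2 then
    match j.2, i.2 with
    | some _, some l => v j.1 l
    | none, none => √(∑ l, v j.1 l ^ 2)
    | _, _ => 0
  else 0

/-- Coefficients of the Gaussian process `(‖v‖ g, ⟨h, v⟩)` in block form. -/
noncomputable def gordonB [DecidableEq k] (v : W → ι → ℝ) (j : W × Option k)
    (i : Option k × Option ι) : ℝ :=
  if i.1 = j.2 then
    match j.2, i.2 with
    | none, some l => v j.1 l
    | some _, none => √(∑ l, v j.1 l ^ 2)
    | _, _ => 0
  else 0

variable [Fintype k] [DecidableEq k] (v : W → ι → ℝ)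

lemma sum_gordonA_some (w : W) (i : k) (x : Option k × Option ι → ℝ) :
    ∑ l, gordonA v (w, some i) l * x l = ∑ l, v w l * x (some i, some l) := by
  simp [Fintype.sum_prod_type, gordonA]

lemma sum_gordonA_none (w : W) (x : Option k × Option ι → ℝ) :
    ∑ l, gordonA v (w, (none : Option k)) l * x l = √(∑ l, v w l ^ 2) * x (none, none) := by
  simp [Fintype.sum_prod_type, gordonA]

lemma sum_gordonB_some (w : W) (i : k) (x : Option k × Option ι → ℝ) :
    ∑ l, gordonB v (w, some i) l * x l = √(∑ l, v w l ^ 2) * x (some i, none) := by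
  simp [Fintype.sum_prod_type, gordonB]

lemma sum_gordonB_none (w : W) (x : Option k × Option ι → ℝ) :
    ∑ l, gordonB v (w, (none : Option k)) l * x l = ∑ l, v w l * x (none, some l) := by
  simp [Fintype.sum_prod_type, gordonB]

lemma sum_gordonA_mul_gordonB (j j' : W × Option k) :
    ∑ i, gordonA v j i * gordonB v j' i = 0 := by
  rcases j with ⟨w, _ | a⟩ <;> rcases j' with ⟨w', _ | a'⟩ <;>
  simp [sum_gordonA_some, sum_gordonA_none] <;> simp [gordonB]

/-- The correlation defect of the two processes at a pair of indices. -/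
noncomputable def defect (w w' : W) : ℝ :=
  √(∑ l, v w l ^ 2) * √(∑ l, v w' l ^ 2) - ∑ l, v w l * v w' l

lemma defect_nonneg (w w' : W) : 0 ≤ defect v w w' :=
  sub_nonneg.2 (Real.sum_mul_le_sqrt_mul_sqrt _ _ _)

lemma defect_self (w : W) : defect v w w = 0 := by
  rw [defect, mul_self_sqrt (by positivity), sub_eq_zero]
  exact Finset.sum_congr rfl fun _ _ => pow_two _

lemma sum_gordonA_sub_gordonB (w w' : W) (a a' : Option k) :
    ∑ i, (gordonA v (w, a) i * gordonA v (w', a') i - gordonB v (w, a) i * gordonB v (w', a') i) =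
      if a = a' then (if a = none then 1 else -1) * defect v w w' else 0 := by
  rw [Finset.sum_sub_distrib]
  rcases a with _ | a <;> rcases a' with _ | a' <;>
  simp only [sum_gordonA_some, sum_gordonA_none, sum_gordonB_some, sum_gordonB_none] <;>
  simp [gordonA, gordonB, defect]
  split_ifs <;> ring

variable [DecidableEq W] [Fintype W] [Nonempty W]

lemma integral_softMin_gordon_le [DecidableEq ι] {ε β : ℝ} (hε : 0 < ε) (hβ : 0 < β) :
    ∫ x, softMin ε β (fun j : W × Option k => ∑ i, gordonB v j i * x i)
        ∂gaussPi (Option k × Option ι) ≤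
      ∫ x, softMin ε β (fun j : W × Option k => ∑ i, gordonA v j i * x i)
        ∂gaussPi (Option k × Option ι) := by
  refine integral_comp_linear_gaussPi_le (C := 1 + 2 / ε + 2 * β) _ _
    (sum_gordonA_mul_gordonB v) (by positivity)
    (hasPartials_softMin hε hβ) (hasPartials_softMin_partial hε) (measurable_softMinHess hε)
    (fun j z => ?_) (fun j l z => ?_) fun z => ?_
  · have : |gibbs ε β j.1 z * blockGrad ε j z| ≤ 1 := by
      rw [abs_mul, abs_of_nonneg (gibbs_nonneg _ _)]
      exact mul_le_one₀ (gibbs_le_one _ _) (abs_nonneg _) (abs_blockGrad_le hε _ _)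
    have : 0 < 2 / ε := by positivity
    linarith
  · linarith [abs_softMinHess_le hε hβ j l z]
  · have h : ∀ j l : W × Option k, _ := fun j l => sum_gordonA_sub_gordonB v j.1 l.1 j.2 l.2
    simp only [Prod.mk.eta] at h
    simp_rw [h, Fintype.sum_prod_type]
    refine Finset.sum_nonneg fun w _ => ?_
    rw [Finset.sum_comm]
    refine Finset.sum_nonneg fun w' _ => ?_
    simp only [mul_ite, mul_zero, Finset.sum_ite_eq, Finset.mem_univ, if_true, Fintype.sum_option]
    rcases eq_or_ne w w' with rfl | hw
    · simp [defect_self]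
    · simp only [reduceCtorEq, if_false, one_mul, softMinHess_of_ne hw, neg_mul, mul_neg,
        Finset.sum_neg_distrib]
      rw [← Finset.sum_mul, ← Finset.mul_sum]
      have h1 := sum_blockGrad_mul_le_one hε w w' z
      have h2 : 0 ≤ β * gibbs ε β w z * gibbs ε β w' z * defect v w w' :=
        mul_nonneg (mul_nonneg (mul_nonneg hβ.le (gibbs_nonneg _ _)) (gibbs_nonneg _ _))
          (defect_nonneg v w w')
      have e : blockGrad ε (w, (none : Option k)) z * blockGrad ε (w', (none : Option k)) z = 1 := by
        simp [blockGrad]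
      rw [e]
      linarith [mul_nonneg h2 (sub_nonneg.2 h1)]

omit [DecidableEq k] in
lemma integrable_softMin {I : Type*} [Fintype I] {ε β : ℝ} (hε : 0 < ε) (hβ : 0 < β)
    (M : W × Option k → I → ℝ) :
    Integrable (fun x : I → ℝ => softMin ε β fun j => ∑ i, M j i * x i) (gaussPi I) := by
  have hd := hasPartials_softMin (W := W) (k := k) hε hβ
  refine integrable_comp_linear_gaussPi (C := 1)
    (continuous_iff_continuousAt.2 fun z => (hd z).continuousAt) zero_le_one
    (abs_le_of_hasFDerivAt hd fun j z => ?_) M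
  rw [abs_mul, abs_of_nonneg (gibbs_nonneg _ _)]
  exact mul_le_one₀ (gibbs_le_one _ _) (abs_nonneg _) (abs_blockGrad_le hε _ _)

omit [DecidableEq k] [Fintype W] [Nonempty W] [DecidableEq W] in
lemma blockNorm_le_add {ε : ℝ} (hε : 0 ≤ ε) (w : W) (z : W × Option k → ℝ) :
    blockNorm ε w z ≤ ε + √(∑ i, z (w, some i) ^ 2) := by
  refine sqrt_le_iff.2 ⟨by positivity, ?_⟩
  have h := sq_sqrt (show 0 ≤ ∑ i, z (w, some i) ^ 2 by positivity)
  nlinarith [mul_nonneg hε (sqrt_nonneg (∑ i, z (w, some i) ^ 2))]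

omit [DecidableEq k] [DecidableEq W] in
/-- Gordon's min-max comparison for a Gaussian matrix acting on a finite set of vectors. -/
theorem integral_ciInf_gordon_le :
    ∫ x, ⨅ w, (√(∑ l, v w l ^ 2) * √(∑ i : k, x (some i, none) ^ 2)
        + ∑ l, v w l * x (none, some l)) ∂gaussPi (Option k × Option ι) ≤
      ∫ x, ⨅ w, √(∑ i : k, (∑ l, v w l * x (some i, some l)) ^ 2)
        ∂gaussPi (Option k × Option ι) := by
  classical
  have hlin : ∀ (w : W) (i : k), Integrable (fun x : Option k × Option ι → ℝ =>
      ∑ l, v w l * x (some i, some l)) (gaussPi _) := fun w i =>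
    integrable_finsetSum _ fun l _ => (integrable_eval_gaussPi _).const_mul _
  have hiR := integrable_ciInf fun w : W => integrable_sqrt_sum_sq (hlin w)
  have hiL : Integrable (fun x : Option k × Option ι → ℝ =>
      ⨅ w, (√(∑ l, v w l ^ 2) * √(∑ i : k, x (some i, none) ^ 2)
        + ∑ l, v w l * x (none, some l))) (gaussPi (Option k × Option ι)) :=
    integrable_ciInf fun w : W => ((integrable_sqrt_sum_sq fun i : k =>
    integrable_eval_gaussPi ((some i, none) : Option k × Option ι)).const_mul
      √(∑ l, v w l ^ 2)).add (integrable_finsetSum Finset.univ fun l _ =>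
        (integrable_eval_gaussPi ((none, some l) : Option k × Option ι)).const_mul (v w l))
  have key : ∀ ε : ℝ, 0 < ε → (∫ x, ⨅ w, (√(∑ l, v w l ^ 2) * √(∑ i : k, x (some i, none) ^ 2)
        + ∑ l, v w l * x (none, some l)) ∂gaussPi (Option k × Option ι)) - ε * log (Fintype.card W)
      ≤ ε + ∫ x, ⨅ w, √(∑ i : k, (∑ l, v w l * x (some i, some l)) ^ 2)
        ∂gaussPi (Option k × Option ι) := by
    intro ε hε
    have hβ := inv_pos.2 hε
    have h := integral_softMin_gordon_le (k := k) v hε hβ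
    have hA := integrable_softMin hε hβ (gordonA (k := k) v)
    have hB := integrable_softMin hε hβ (gordonB (k := k) v)
    have h1 : (∫ x, ⨅ w, (√(∑ l, v w l ^ 2) * √(∑ i : k, x (some i, none) ^ 2)
        + ∑ l, v w l * x (none, some l)) ∂gaussPi (Option k × Option ι))
        - ε * log (Fintype.card W) ≤ ∫ x, softMin ε ε⁻¹
          (fun j : W × Option k => ∑ i, gordonB v j i * x i) ∂gaussPi (Option k × Option ι) := by
      have : ∀ c : ℝ, c = ∫ x, c ∂gaussPi (Option k × Option ι) := by simp
      rw [this (ε * log _), ← integral_sub hiL (integrable_const _)]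
      refine integral_mono (hiL.sub (integrable_const _)) hB fun x => ?_
      have := le_softMin (ε := ε) hβ (z := fun j : W × Option k => ∑ i, gordonB v j i * x i)
        (c := ⨅ w, (√(∑ l, v w l ^ 2) * √(∑ i : k, x (some i, none) ^ 2)
        + ∑ l, v w l * x (none, some l))) fun w => by
          refine (ciInf_le (Set.finite_range _).bddBelow w).trans ?_
          simp only [blockEnergy, sum_gordonB_none, blockNorm, sum_gordonB_some, mul_pow]
          refine add_le_add_left ?_ _
          rw [← Finset.mul_sum, ← sqrt_mul' _ (by positivity), sq_sqrt (by positivity)]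
          exact sqrt_le_sqrt (le_add_of_nonneg_left (by positivity))
      simpa using this
    have h2 : ∫ x, softMin ε ε⁻¹
          (fun j : W × Option k => ∑ i, gordonA v j i * x i) ∂gaussPi (Option k × Option ι) ≤
        ε + ∫ x, ⨅ w, √(∑ i : k, (∑ l, v w l * x (some i, some l)) ^ 2)
        ∂gaussPi (Option k × Option ι) := by
      have hneg := integral_neg_eq_self (fun x => softMin ε ε⁻¹
          (fun j : W × Option k => ∑ i, gordonA v j i * x i)) (gaussPi (Option k × Option ι))
      have hAn := hA.comp_neg
      have h3 : ∫ x, (softMin ε ε⁻¹ (fun j : W × Option k => ∑ i, gordonA v j i * x i)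
          + softMin ε ε⁻¹ (fun j : W × Option k => ∑ i, gordonA v j i * (-x) i))
          ∂gaussPi (Option k × Option ι) ≤
          ∫ x, 2 * (ε + ⨅ w, √(∑ i : k, (∑ l, v w l * x (some i, some l)) ^ 2))
          ∂gaussPi (Option k × Option ι) := by
        refine integral_mono (hA.add hAn) (((integrable_const ε).add hiR).const_mul 2) fun x => ?_
        obtain ⟨w, hw⟩ := exists_eq_ciInf_of_finite
          (f := fun w => √(∑ i : k, (∑ l, v w l * x (some i, some l)) ^ 2))
        simp only
        rw [← hw]
        have a1 := softMin_le (ε := ε) hβ w (fun j : W × Option k => ∑ i, gordonA v j i * x i)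
        have a2 := softMin_le (ε := ε) hβ w (fun j : W × Option k => ∑ i, gordonA v j i * (-x) i)
        have b1 := blockNorm_le_add hε.le w (fun j : W × Option k => ∑ i, gordonA v j i * x i)
        have b2 := blockNorm_le_add hε.le w (fun j : W × Option k => ∑ i, gordonA v j i * (-x) i)
        simp only [blockEnergy, sum_gordonA_none, sum_gordonA_some] at a1 a2 b1 b2
        have e1 : (-x) (none, none) = -x (none, none) := rfl
        have e2 : ∑ i : k, (∑ l, v w l * (-x) (some i, some l)) ^ 2 =
            ∑ i : k, (∑ l, v w l * x (some i, some l)) ^ 2 := by simp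
        rw [e1, mul_neg] at a2
        rw [e2] at b2
        linarith
      rw [integral_add hA hAn, hneg, integral_const_mul, integral_add (integrable_const _) hiR] at h3
      simp only [integral_const, probReal_univ, one_smul] at h3
      linarith
    linarith
  refine le_of_forall_pos_le_add fun δ hδ => ?_
  have hL : 0 ≤ log (Fintype.card W) := log_natCast_nonneg _
  have := key (δ / (1 + log (Fintype.card W))) (by positivity)
  have e : δ / (1 + log (Fintype.card W)) + δ / (1 + log (Fintype.card W)) * log (Fintype.card W)
    = δ := by field_simp
  linarith

end Gordon

/-- The expected positive part of `t - g` for a standard Gaussian `g`. -/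
noncomputable def hinge (t : ℝ) : ℝ := ∫ x, max (t - x) 0 ∂gaussianReal 0 1

/-- The standard Gaussian distribution function. -/
noncomputable def gaussCdf (t : ℝ) : ℝ := ∫ x in Set.Iic t, gaussianPDFReal 0 1 x

lemma integrable_hinge (t : ℝ) : Integrable (fun x : ℝ => max (t - x) 0) (gaussianReal 0 1) :=
  ((integrable_const t).sub integrable_id_gaussianReal).sup (integrable_const 0)

lemma memLp_hinge (t : ℝ) : MemLp (fun x : ℝ => max (t - x) 0) 2 (gaussianReal 0 1) :=
  ((memLp_const t).sub (memLp_id_gaussianReal (μ := 0) (v := 1) 2)).sup (memLp_const 0)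

lemma hinge_nonneg (t : ℝ) : 0 ≤ hinge t := integral_nonneg fun _ => le_max_right _ _

lemma hinge_neg (t : ℝ) : hinge (-t) = hinge t - t := by
  have h1 : hinge (-t) = ∫ x, max (-t - -x) 0 ∂gaussianReal 0 1 :=
    (integral_neg_eq_self (fun x => max (-t - x) 0) (gaussianReal 0 1)).symm
  have h2 : ∫ x, (t - x) ∂gaussianReal 0 1 = t := by
    rw [integral_sub (integrable_const _) integrable_id_gaussianReal]
    simp [integral_id_gaussianReal]
  rw [h1, hinge]
  nth_rw 3 [← h2]
  have hi : Integrable (fun x : ℝ => t - x) (gaussianReal 0 1) :=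
    (integrable_const _).sub integrable_id_gaussianReal
  rw [← integral_sub (integrable_hinge t) hi]
  congr 1
  ext x
  rcases le_total (t - x) 0 with h | h
  · rw [max_eq_right h, max_eq_left (by linarith)]; ring
  · rw [max_eq_left h, max_eq_right (by linarith)]; ring

lemma abs_hinge_sub_le (t t' : ℝ) : |hinge t - hinge t'| ≤ |t - t'| := by
  rw [hinge, hinge, ← integral_sub (integrable_hinge t) (integrable_hinge t')]
  have h : ∀ᵐ x ∂gaussianReal 0 1, ‖max (t - x) 0 - max (t' - x) 0‖ ≤ |t - t'| :=
    ae_of_all _ fun x => (abs_max_sub_max_le_abs _ _ _).trans (by rw [sub_sub_sub_cancel_right])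
  simpa using norm_integral_le_of_norm_le_const h

lemma integral_sq_gaussianReal : ∫ x, x ^ 2 ∂gaussianReal 0 1 = 1 := by
  have h := variance_id_gaussianReal (μ := 0) (v := 1)
  rw [variance_eq_sub (memLp_id_gaussianReal (μ := 0) (v := 1) 2)] at h
  simpa [integral_id_gaussianReal] using h

lemma hinge_neg_le {M : ℝ} (hM : 0 < M) : hinge (-M) ≤ 1 / (4 * M) := by
  have hi : Integrable (fun x : ℝ => x ^ 2) (gaussianReal 0 1) :=
    (memLp_id_gaussianReal (μ := 0) (v := 1) 2).integrable_sq
  calc hinge (-M) ≤ ∫ x, x ^ 2 / (4 * M) ∂gaussianReal 0 1 := by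
        refine integral_mono (integrable_hinge _) (hi.div_const _) fun x => max_le ?_ (by positivity)
        rw [le_div_iff₀ (by positivity)]
        nlinarith [sq_nonneg (x + 2 * M)]
    _ = _ := by rw [integral_div, integral_sq_gaussianReal]

lemma tendsto_gaussianPDFReal_atBot : Tendsto (gaussianPDFReal 0 1) atBot (nhds 0) := by
  rw [gaussianPDFReal_def, ← mul_zero ((√(2 * π * (1 : NNReal)))⁻¹)]
  refine Tendsto.const_mul _ (tendsto_exp_atBot.comp ?_)
  simp only [neg_div, NNReal.coe_one, mul_one]
  exact tendsto_neg_atTop_atBot.comp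
    ((tendsto_pow_atTop two_ne_zero |>.comp tendsto_neg_atBot_atTop |>.congr fun x => by simp)
      |>.atTop_div_const two_pos)

lemma hinge_eq (t : ℝ) : hinge t = t * gaussCdf t + gaussianPDFReal 0 1 t := by
  have hi : Integrable (fun x => -x * gaussianPDFReal 0 1 x) :=
    (integrable_gaussianReal_iff.1 integrable_id_gaussianReal).neg.congr
      (ae_of_all _ fun x => by simp only [Pi.neg_apply]; ring)
  have h1 := integral_Iic_of_hasDerivAt_of_tendsto' (a := t)
    (fun x _ => hasDerivAt_gaussianPDFReal x) hi.integrableOn tendsto_gaussianPDFReal_atBot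
  rw [sub_zero] at h1
  rw [← h1, gaussCdf, ← integral_const_mul, ← integral_add
    ((integrable_gaussianPDFReal 0 1).const_mul t).integrableOn hi.integrableOn, hinge,
    integral_gaussianReal_eq_integral_smul one_ne_zero, ← integral_indicator measurableSet_Iic]
  congr 1
  ext x
  by_cases hx : x ≤ t
  · rw [Set.indicator_of_mem (Set.mem_Iic.2 hx), max_eq_left (by linarith), smul_eq_mul]; ring
  · rw [Set.indicator_of_notMem (by simpa using hx), max_eq_right (by linarith), smul_zero]

lemma gaussCdf_nonneg (t : ℝ) : 0 ≤ gaussCdf t :=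
  integral_nonneg fun _ => gaussianPDFReal_nonneg _ _ _

lemma gaussCdf_le_one (t : ℝ) : gaussCdf t ≤ 1 := by
  rw [← integral_gaussianPDFReal_eq_one 0 one_ne_zero]
  exact setIntegral_le_integral (integrable_gaussianPDFReal 0 1)
    (ae_of_all _ fun _ => gaussianPDFReal_nonneg _ _ _)

lemma gaussianPDFReal_standard (x : ℝ) :
    gaussianPDFReal 0 1 x = (√(2 * π))⁻¹ * rexp (-x ^ 2 / 2) := by
  simp [gaussianPDFReal]

lemma gaussCdf_zero : gaussCdf 0 = 1 / 2 := by
  have h1 : gaussCdf 0 = ∫ x in Set.Ioi (0 : ℝ), gaussianPDFReal 0 1 x := by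
    have := integral_comp_neg_Iic (0 : ℝ) (gaussianPDFReal 0 1)
    rw [neg_zero] at this
    rw [← this, gaussCdf]
    simp [gaussianPDFReal]
  have h2 := intervalIntegral.integral_Iic_add_Ioi (b := (0 : ℝ))
    (integrable_gaussianPDFReal 0 1).integrableOn (integrable_gaussianPDFReal 0 1).integrableOn
  rw [integral_gaussianPDFReal_eq_one 0 one_ne_zero, ← h1] at h2
  rw [← gaussCdf] at h2
  linarith

lemma two_mul_gaussCdf (s : ℝ) : 2 * gaussCdf (-(√2 * s)) = 1 - erf s := by
  have h1 := intervalIntegral.integral_Iic_sub_Iic (a := (0 : ℝ)) (b := -(√2 * s))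
    (integrable_gaussianPDFReal 0 1).integrableOn (integrable_gaussianPDFReal 0 1).integrableOn
  rw [← gaussCdf, ← gaussCdf, gaussCdf_zero] at h1
  have h2 := intervalIntegral.mul_integral_comp_mul_left (a := (0 : ℝ)) (b := s)
    (f := gaussianPDFReal 0 1) (c := -√2)
  have h3 : ∀ x : ℝ, gaussianPDFReal 0 1 (-√2 * x) = (√(2 * π))⁻¹ * rexp (-x ^ 2) := by
    intro x
    rw [gaussianPDFReal_standard, mul_pow, neg_sq, sq_sqrt zero_le_two]
    congr 2
    ring
  simp_rw [h3, intervalIntegral.integral_const_mul, mul_zero, neg_mul] at h2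
  rw [← h2] at h1
  rw [erf, eq_add_of_sub_eq h1, sqrt_mul zero_le_two]
  have := sqrt_pos.2 pi_pos
  have := sqrt_pos.2 (zero_lt_two (α := ℝ))
  field_simp
  ring

lemma two_mul_gaussianPDFReal (s : ℝ) :
    2 * gaussianPDFReal 0 1 (-(√2 * s)) = √(2 / π) * rexp (-s ^ 2) := by
  rw [gaussianPDFReal_standard, neg_sq, mul_pow, sq_sqrt zero_le_two, sqrt_mul zero_le_two,
    sqrt_div zero_le_two]
  have := sqrt_pos.2 pi_pos
  have h2 := sqrt_pos.2 (zero_lt_two (α := ℝ))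
  have e : -(2 * s ^ 2) / 2 = -s ^ 2 := by ring
  rw [e]
  have h3 := sq_sqrt (zero_le_two (α := ℝ))
  field_simp
  linarith

/-- A finite set of thresholds nearly attains the dual value `√(2/π) exp(-erfinv(c)²)`,
uniformly in `c`. -/
lemma exists_threshold {M δ : ℝ} (hM : 0 < M) {T : Finset ℝ}
    (hT : ∀ τ ∈ Set.Icc (-M) M, ∃ t ∈ T, |t - τ| ≤ δ) (hTM : M ∈ T) (hTM' : -M ∈ T) (s : ℝ) :
    ∃ t ∈ T, -(√(2 / π) * rexp (-s ^ 2)) - (1 / (2 * M) + 4 * δ) ≤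
      (1 - erf s) * t - 2 * hinge t := by
  obtain ⟨t₀, -, ht₀⟩ := hT 0 ⟨by linarith, by linarith⟩
  have hδ : 0 ≤ δ := (abs_nonneg _).trans ht₀
  rw [← two_mul_gaussCdf, ← two_mul_gaussianPDFReal]
  set τ := -(√2 * s)
  have hM1 := hinge_neg_le hM
  have hM2 : 1 / (2 * M) = 2 * (1 / (4 * M)) := by field_simp; norm_num
  have p0 := gaussCdf_nonneg τ
  have p1 := gaussCdf_le_one τ
  have e := hinge_eq τ
  have n0 := hinge_nonneg τ
  have n1 := hinge_nonneg (-τ)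
  have e1 := hinge_neg τ
  have e2 := hinge_neg M
  rcases le_or_gt τ (-M) with h | h
  · exact ⟨-M, hTM', by nlinarith⟩
  rcases le_or_gt M τ with h' | h'
  · exact ⟨M, hTM, by nlinarith⟩
  obtain ⟨t, ht, htτ⟩ := hT τ ⟨h.le, h'.le⟩
  refine ⟨t, ht, ?_⟩
  have l := (abs_le.1 ((abs_hinge_sub_le t τ).trans htτ)).2
  have l' := (abs_le.1 htτ).1
  have : gaussCdf τ * (t - τ) ≥ -δ := by nlinarith
  have : 0 < 1 / (2 * M) := by positivity
  nlinarith

lemma measurePreserving_comp_gaussPi {I κ : Type*} [Fintype I] [Fintype κ] {e : κ → I}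
    (he : Function.Injective e) :
    MeasurePreserving (fun (x : I → ℝ) i => x (e i)) (gaussPi I) (gaussPi κ) := by
  refine ⟨by fun_prop, ?_⟩
  have h : iIndepFun (fun i (x : I → ℝ) => x i) (gaussPi I) :=
    iIndepFun_pi (X := fun _ x => x) fun _ => aemeasurable_id
  rw [(iIndepFun_iff_map_fun_eq_pi_map fun i => (measurable_pi_apply (e i)).aemeasurable).1
    (h.precomp he)]
  congr 1
  ext1 i
  exact (measurePreserving_eval (fun _ : I => gaussianReal 0 1) (e i)).map_eq

lemma measurePreserving_curry_gaussPi {k ι : Type*} [Fintype k] [Fintype ι] :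
    MeasurePreserving (fun (x : k × ι → ℝ) i j => x (i, j)) (gaussPi (k × ι))
      (Measure.pi fun _ => gaussPi ι) := by
  let f : (k → ι → ℝ) ≃ᵐ (k × ι → ℝ) :=
    { toEquiv := (Equiv.curry k ι ℝ).symm
      measurable_toFun := measurable_equivCurry_symm
      measurable_invFun := measurable_equivCurry }
  have hf : MeasurePreserving f (Measure.pi fun _ => gaussPi ι) (gaussPi (k × ι)) := by
    refine ⟨f.measurable, (Measure.pi_eq fun s hs => ?_).symm⟩
    rw [Measure.map_apply f.measurable (MeasurableSet.univ_pi hs), Fintype.prod_prod_type]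
    have : f ⁻¹' (Set.univ.pi s) = Set.univ.pi fun a => Set.univ.pi fun b => s (a, b) := by
      ext x
      simp [Set.mem_pi, f, Function.uncurry]
    simp_rw [this, Measure.pi_pi]
  exact hf.symm

lemma measurePreserving_gaussPi_blocks {I k ι : Type*} [Fintype I] [Fintype k] [Fintype ι]
    {e : k × ι ⊕ k → I} (he : Function.Injective e) :
    MeasurePreserving (fun x : I → ℝ =>
        ((fun i j => x (e (.inl (i, j))), fun i => x (e (.inr i))) : (k → ι → ℝ) × (k → ℝ)))
      (gaussPi I) ((Measure.pi fun _ => gaussPi ι).prod (gaussPi k)) :=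
  ((measurePreserving_curry_gaussPi (k := k) (ι := ι)).prod (MeasurePreserving.id (gaussPi k))).comp
    ((measurePreserving_sumPiEquivProdPi (ι := k × ι) (ι' := k) fun _ => gaussianReal 0 1).comp
      (measurePreserving_comp_gaussPi he))

lemma integral_abs_sum_sub_le {I κ : Type*} [Fintype I] [Fintype κ] {e : κ → I}
    (he : Function.Injective e) {φ : ℝ → ℝ} (hφ : MemLp φ 2 (gaussianReal 0 1)) :
    ∫ x, |∑ i, φ (x (e i)) - Fintype.card κ * ∫ y, φ y ∂gaussianReal 0 1| ∂gaussPi I ≤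
      √(Fintype.card κ * Var[φ; gaussianReal 0 1]) := by
  set c := ∫ y, φ y ∂gaussianReal 0 1
  have hL : ∀ i : I, MemLp (fun x : I → ℝ => φ (x i)) 2 (gaussPi I) := fun i =>
    hφ.comp_measurePreserving (measurePreserving_eval (fun _ : I => gaussianReal 0 1) i)
  have hE : ∀ i : I, ∫ x, φ (x i) ∂gaussPi I = c := fun i =>
    integral_comp_eval (μ := fun _ : I => gaussianReal 0 1) hφ.1
  have hm : MemLp (fun x : I → ℝ => ∑ i, φ (x (e i))) 2 (gaussPi I) :=
    memLp_finsetSum _ fun i _ => hL (e i)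
  have hEs : ∫ x, ∑ i, φ (x (e i)) ∂gaussPi I = Fintype.card κ * c := by
    rw [integral_finsetSum _ fun i _ => (hL (e i)).integrable one_le_two]
    simp [hE]
  have hi : iIndepFun (fun i (x : I → ℝ) => φ (x i)) (gaussPi I) :=
    iIndepFun_pi (X := fun _ => φ) fun _ => hφ.1.aemeasurable
  have hV : ∀ i : I, Var[fun x : I → ℝ => φ (x i); gaussPi I] = Var[φ; gaussianReal 0 1] := by
    intro i
    have h := (measurePreserving_eval (fun _ : I => gaussianReal 0 1) i)
    conv_rhs => rw [← h.map_eq]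
    rw [variance_map (by rw [h.map_eq]; exact hφ.1.aemeasurable) h.measurable.aemeasurable]
    rfl
  have hVs : Var[fun x : I → ℝ => ∑ i, φ (x (e i)); gaussPi I] =
      Fintype.card κ * Var[φ; gaussianReal 0 1] := by
    have := IndepFun.variance_sum (s := Finset.univ) (fun i _ => hL (e i))
      fun i _ j _ hij => hi.indepFun (he.ne hij)
    simp only [hV, Finset.sum_const, Finset.card_univ, nsmul_eq_mul] at this
    rw [← this]
    congr 1
    ext x
    simp
  have hd : MemLp (fun x : I → ℝ => |∑ i, φ (x (e i)) - Fintype.card κ * c|) 2 (gaussPi I) :=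
    (hm.sub (memLp_const _)).abs
  have h0 := variance_nonneg (fun x : I → ℝ => |∑ i, φ (x (e i)) - Fintype.card κ * c|) (gaussPi I)
  rw [variance_eq_sub hd] at h0
  refine le_sqrt_of_sq_le ?_
  rw [← hVs, variance_eq_integral hm.aemeasurable, hEs]
  simpa using h0

/-- The point of the hypercube `{±1/√n}ⁿ` with sign pattern `w`. -/
noncomputable def cubePoint {n : ℕ} (w : Fin n → Bool) (j : Fin n) : ℝ :=
  if w j then 1 / √n else -(1 / √n)

/-- The error vector `x_sol - x`, extended by the noise level `σ`. -/
noncomputable def errorVec {n : ℕ} (σ : ℝ) (w : Fin n → Bool) (l : Option (Fin n)) : ℝ :=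
  l.elim σ fun j => 1 / √n - cubePoint w j

/-- The overlap `⟨x_sol, x⟩`. -/
noncomputable def overlap {n : ℕ} (w : Fin n → Bool) : ℝ := ∑ j, 1 / √n * cubePoint w j

lemma range_cubePoint (n : ℕ) : Set.range (cubePoint (n := n)) =
    {x : Fin n → ℝ | ∀ i, x i = 1 / √n ∨ x i = -(1 / √n)} := by
  ext x
  constructor
  · rintro ⟨w, rfl⟩ i
    unfold cubePoint
    split_ifs <;> simp
  · intro hx
    classical
    refine ⟨fun j => decide (x j = 1 / √n), ?_⟩
    ext j
    rcases eq_or_ne (x j) (1 / √n) with h | h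
    · simp [cubePoint, h]
    · simp only [cubePoint, decide_eq_true_eq, if_neg h]
      exact ((hx j).resolve_left h).symm

lemma one_div_sqrt_sq (n : ℕ) : (1 / √n : ℝ) ^ 2 = 1 / n := by
  rw [div_pow, one_pow, sq_sqrt n.cast_nonneg]

lemma overlap_mem {n : ℕ} (hn : 0 < n) (w : Fin n → Bool) : overlap w ∈ Set.Icc (-1 : ℝ) 1 := by
  have hn' : (n : ℝ) ≠ 0 := by positivity
  have h : ∀ j, |1 / √n * cubePoint w j| = 1 / n := by
    intro j
    rw [← one_div_sqrt_sq, sq, abs_mul, abs_of_nonneg (a := 1 / √n) (by positivity)]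
    unfold cubePoint
    split_ifs <;> simp
  refine abs_le.1 ((Finset.abs_sum_le_sum_abs _ _).trans ?_)
  simp only [h, Finset.sum_const, Finset.card_univ, Fintype.card_fin, nsmul_eq_mul,
    mul_one_div_cancel hn', le_refl]

lemma sum_errorVec_sq {n : ℕ} (hn : 0 < n) (σ : ℝ) (w : Fin n → Bool) :
    ∑ l, errorVec σ w l ^ 2 = 2 - 2 * overlap w + σ ^ 2 := by
  have hn' : (n : ℝ) ≠ 0 := by positivity
  have h : ∀ j, (1 / √n - cubePoint w j) ^ 2 = 2 * (1 / n) - 2 * (1 / √n * cubePoint w j) := by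
    intro j
    have : cubePoint w j ^ 2 = 1 / n := by
      rw [← one_div_sqrt_sq]
      unfold cubePoint
      split_ifs <;> simp
    rw [sub_sq, one_div_sqrt_sq, this]
    ring
  rw [Fintype.sum_option]
  simp only [errorVec, Option.elim, h, Finset.sum_sub_distrib, ← Finset.mul_sum, Finset.sum_const,
    Finset.card_univ, Fintype.card_fin, nsmul_eq_mul, overlap]
  field_simp
  ring

lemma le_sum_errorVec_mul {n : ℕ} (hn : 0 < n) (σ t : ℝ) (w : Fin n → Bool)
    (h : Option (Fin n) → ℝ) :
    (1 - overlap w) * t - 2 * ((∑ j, max (t - h (some j)) 0) / n) + 1 / √n * (σ * h none) ≤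
      1 / √n * ∑ l, errorVec σ w l * h l := by
  have hn' : (n : ℝ) ≠ 0 := by positivity
  have key : ∀ j, (1 / n - 1 / √n * cubePoint w j) * t - 2 / n * max (t - h (some j)) 0 ≤
      1 / √n * ((1 / √n - cubePoint w j) * h (some j)) := by
    intro j
    rw [← one_div_sqrt_sq]
    have h2 : (2 / n : ℝ) = 2 * (1 / √n) ^ 2 := by rw [one_div_sqrt_sq]; ring
    have hp : 0 ≤ (1 / √n : ℝ) ^ 2 := by positivity
    have := le_max_left (t - h (some j)) 0
    have := le_max_right (t - h (some j)) 0
    rw [h2]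
    unfold cubePoint
    split_ifs <;> nlinarith
  have hs := Finset.sum_le_sum fun j (_ : j ∈ Finset.univ) => key j
  rw [Finset.sum_sub_distrib, ← Finset.sum_mul, ← Finset.mul_sum, ← Finset.mul_sum,
    Finset.sum_sub_distrib, ← overlap] at hs
  simp only [Finset.sum_const, Finset.card_univ, Fintype.card_fin, nsmul_eq_mul,
    mul_one_div_cancel hn'] at hs
  rw [Fintype.sum_option, mul_add]
  simp only [errorVec, Option.elim]
  have e : 2 / (n : ℝ) * ∑ j, max (t - h (some j)) 0 = 2 * ((∑ j, max (t - h (some j)) 0) / n) := by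
    ring
  linarith

lemma abs_sqrt_sub_sqrt_le {a b : ℝ} (ha : 0 ≤ a) (hb : 0 < b) : |√a - √b| ≤ |a - b| / √b := by
  have h : a - b = (√a - √b) * (√a + √b) := by
    linear_combination (mul_self_sqrt hb.le) - mul_self_sqrt ha
  have hb' := sqrt_pos.2 hb
  rw [le_div_iff₀ hb', h, abs_mul, abs_of_nonneg (a := √a + √b) (by positivity)]
  gcongr
  linarith [sqrt_nonneg a]

/-- Deterministic lower bound on the auxiliary objective in Gordon's comparison. -/
lemma le_auxiliary_objective {n : ℕ} (hn : 0 < n) {α σ b : ℝ} (hα : 0 < α) {T : Finset ℝ}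
    (hT : ∀ c ∈ Set.Icc (-1 : ℝ) 1, ∃ t ∈ T,
      b ≤ √α * √(2 - 2 * c + σ ^ 2) + ((1 - c) * t - 2 * hinge t))
    (w : Fin n → Bool) {r : ℝ} (hr : 0 ≤ r) (h : Option (Fin n) → ℝ) :
    b - √(4 + σ ^ 2) * (|r / n - α| / √α)
        - 2 * ∑ t ∈ T, |(∑ j, max (t - h (some j)) 0) / n - hinge t| + 1 / √n * (σ * h none) ≤
      1 / √n * (√(∑ l, errorVec σ w l ^ 2) * √r + ∑ l, errorVec σ w l * h l) := by
  obtain ⟨t, ht, hb⟩ := hT _ (overlap_mem hn w)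
  have h1 := le_sum_errorVec_mul hn σ t w h
  have h2 := Finset.single_le_sum (f := fun t => |(∑ j, max (t - h (some j)) 0) / n - hinge t|)
    (fun _ _ => abs_nonneg _) ht
  have h3 := le_abs_self ((∑ j, max (t - h (some j)) 0) / n - hinge t)
  have h4 : √(∑ l, errorVec σ w l ^ 2) * (√α - √(r / n)) ≤ √(4 + σ ^ 2) * (|r / n - α| / √α) := by
    have h5 := abs_sqrt_sub_sqrt_le (a := r / n) (by positivity) hα
    rw [abs_sub_comm] at h5
    have h6 : √(∑ l, errorVec σ w l ^ 2) ≤ √(4 + σ ^ 2) := by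
      rw [sum_errorVec_sq hn]
      exact sqrt_le_sqrt (by linarith [(overlap_mem hn w).1])
    exact (mul_le_mul_of_nonneg_left ((le_abs_self _).trans h5) (sqrt_nonneg _)).trans
      (mul_le_mul_of_nonneg_right h6 (by positivity))
  rw [mul_sub, sqrt_div hr] at h4
  rw [← sum_errorVec_sq hn] at hb
  have e : 1 / √n * (√(∑ l, errorVec σ w l ^ 2) * √r + ∑ l, errorVec σ w l * h l) =
      √(∑ l, errorVec σ w l ^ 2) * (√r / √n) + 1 / √n * ∑ l, errorVec σ w l * h l := by ring
  rw [e]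
  linarith

lemma memLp_sq_gaussianReal : MemLp (fun x : ℝ => x ^ 2) 2 (gaussianReal 0 1) := by
  have h := (memLp_id_gaussianReal (μ := 0) (v := 1) (4 : ℕ)).integrable_norm_pow four_ne_zero
  rw [memLp_two_iff_integrable_sq (by fun_prop)]
  refine h.congr (ae_of_all _ fun x => ?_)
  simp only [id, Real.norm_eq_abs]
  rw [← pow_mul, Even.pow_abs ⟨2, rfl⟩]

lemma memLp_comp_eval_gaussPi {I : Type*} [Fintype I] {φ : ℝ → ℝ}
    (hφ : MemLp φ 2 (gaussianReal 0 1)) (i : I) :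
    MemLp (fun x : I → ℝ => φ (x i)) 2 (gaussPi I) :=
  hφ.comp_measurePreserving (measurePreserving_eval (fun _ : I => gaussianReal 0 1) i)

/-- The mean optimal value of the original problem, on a single Gaussian space. -/
noncomputable def mlValue (σ : ℝ) (m n : ℕ) : ℝ :=
  ∫ x, ⨅ w : Fin n → Bool,
    √(∑ i : Fin m, (∑ l, errorVec σ w l * x (some i, some l)) ^ 2)
    ∂gaussPi (Option (Fin m) × Option (Option (Fin n)))

lemma integral_sInf_eq_mlValue (σ : ℝ) (m n : ℕ) :
    ∫ p : (Fin m → Fin n → ℝ) × (Fin m → ℝ),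
        sInf ((fun x : Fin n → ℝ =>
          √(∑ i, (∑ j, p.1 i j * (1 / √n - x j) + σ * p.2 i) ^ 2)) ''
          {x : Fin n → ℝ | ∀ i, x i = 1 / √n ∨ x i = -(1 / √n)})
        ∂((Measure.pi fun _ => gaussPi (Fin n)).prod (gaussPi (Fin m))) = mlValue σ m n := by
  let e : Fin m × Fin n ⊕ Fin m → Option (Fin m) × Option (Option (Fin n)) :=
    Sum.elim (fun q => (some q.1, some (some q.2))) fun i => (some i, some none)
  have he : Function.Injective e := by
    rintro (⟨a, b⟩ | a) (⟨c, d⟩ | c) h <;> simp_all [e]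
  have hmp := measurePreserving_gaussPi_blocks he
  simp_rw [← range_cubePoint, ← Set.range_comp]
  have hm : Measurable fun p : (Fin m → Fin n → ℝ) × (Fin m → ℝ) =>
      ⨅ w : Fin n → Bool, √(∑ i, (∑ j, p.1 i j * (1 / √n - cubePoint w j) + σ * p.2 i) ^ 2) :=
    Measurable.iInf fun w => by fun_prop
  have key := integral_map
    (μ := gaussPi (Option (Fin m) × Option (Option (Fin n)))) hmp.measurable.aemeasurable (hm.aestronglyMeasurable)
  rw [hmp.map_eq] at key
  refine key.trans ?_
  unfold mlValue
  congr 1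
  ext x
  congr 1
  ext w
  simp only [Fintype.sum_option, errorVec, Option.elim, e, Sum.elim_inl, Sum.elim_inr]
  congr 2
  ext i
  rw [add_comm]
  congr 3
  ext j
  rw [mul_comm]

lemma mlValue_ge {m n : ℕ} (hn : 0 < n) {α σ b : ℝ} (hα : 0 < α) {T : Finset ℝ}
    (hT : ∀ c ∈ Set.Icc (-1 : ℝ) 1, ∃ t ∈ T,
      b ≤ √α * √(2 - 2 * c + σ ^ 2) + ((1 - c) * t - 2 * hinge t)) :
    b - √(4 + σ ^ 2) / √α * (√(m * Var[fun x => x ^ 2; gaussianReal 0 1]) / n + |(m : ℝ) / n - α|)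
        - 2 * ∑ t ∈ T, √(n * Var[fun x => max (t - x) 0; gaussianReal 0 1]) / n ≤
      1 / √n * mlValue σ m n := by
  have hn' : (n : ℝ) ≠ 0 := by positivity
  have hn0 : (0 : ℝ) < n := by positivity
  have hG := integral_ciInf_gordon_le (k := Fin m) (errorVec (n := n) σ)
  refine le_trans ?_ (mul_le_mul_of_nonneg_left hG (by positivity))
  set μ := gaussPi (Option (Fin m) × Option (Option (Fin n)))
  set K := √(4 + σ ^ 2) / √α
  have hI := fun i => integrable_eval_gaussPi (I := Option (Fin m) × Option (Option (Fin n))) i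
  rw [← integral_const_mul]
  let d (x : Option (Fin m) × Option (Option (Fin n)) → ℝ) : ℝ :=
    |∑ i : Fin m, x (some i, none) ^ 2 - m * ∫ y, y ^ 2 ∂gaussianReal 0 1|
  let f (t : ℝ) (x : Option (Fin m) × Option (Option (Fin n)) → ℝ) : ℝ :=
    |∑ j : Fin n, max (t - x (none, some (some j))) 0 -
      n * ∫ y, max (t - y) 0 ∂gaussianReal 0 1|
  have hd : Integrable d μ := by
    refine Integrable.abs (Integrable.sub (integrable_finsetSum _ fun i _ => ?_)
      (integrable_const _))
    exact (memLp_comp_eval_gaussPi memLp_sq_gaussianReal _).integrable one_le_two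
  have hf : ∀ t, Integrable (f t) μ := by
    intro t
    refine Integrable.abs (Integrable.sub (integrable_finsetSum _ fun i _ => ?_)
      (integrable_const _))
    exact (memLp_comp_eval_gaussPi (memLp_hinge t) _).integrable one_le_two
  have hd' : ∫ x, d x ∂μ ≤ √(m * Var[fun x => x ^ 2; gaussianReal 0 1]) := by
    have := integral_abs_sum_sub_le (I := Option (Fin m) × Option (Option (Fin n)))
      (e := fun i : Fin m => (some i, none)) (fun a b h => by simpa using h) memLp_sq_gaussianReal
    rwa [Fintype.card_fin] at this
  have hf' : ∀ t, ∫ x, f t x ∂μ ≤ √(n * Var[fun x => max (t - x) 0; gaussianReal 0 1]) := by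
    intro t
    have := integral_abs_sum_sub_le (I := Option (Fin m) × Option (Option (Fin n)))
      (e := fun j : Fin n => (none, some (some j))) (fun a b h => by simpa using h) (memLp_hinge t)
    rwa [Fintype.card_fin] at this
  have hpt : ∀ x, b - K * |(m : ℝ) / n - α| - K / n * d x - 2 * ∑ t ∈ T, f t x / n
      + 1 / √n * (σ * x (none, some none)) ≤
      1 / √n * ⨅ w, (√(∑ l, errorVec σ w l ^ 2) * √(∑ i : Fin m, x (some i, none) ^ 2) +
        ∑ l, errorVec σ w l * x (none, some l)) := by
    intro x
    obtain ⟨w, hw⟩ := exists_eq_ciInf_of_finite (f := fun w : Fin n → Bool =>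
      √(∑ l, errorVec σ w l ^ 2) * √(∑ i : Fin m, x (some i, none) ^ 2) +
        ∑ l, errorVec σ w l * x (none, some l))
    rw [← hw]
    refine le_trans ?_ (le_auxiliary_objective hn hα hT w
      (Finset.sum_nonneg fun i _ => sq_nonneg (x (some i, none))) fun l => x (none, some l))
    have e1 : ∀ t, |(∑ j, max (t - x (none, some (some j))) 0) / n - hinge t| = f t x / n := by
      intro t
      simp only [f]
      rw [← hinge, ← abs_of_pos hn0, ← abs_div, abs_of_pos hn0, sub_div,
        mul_div_cancel_left₀ _ hn']
    have e2 : |(∑ i : Fin m, x (some i, none) ^ 2) / n - α| ≤ d x / n + |(m : ℝ) / n - α| := by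
      have e3 : d x / n = |(∑ i : Fin m, x (some i, none) ^ 2) / n - m / n| := by
        simp only [d]
        rw [integral_sq_gaussianReal, mul_one, ← abs_of_pos hn0, ← abs_div,
          abs_of_pos hn0, sub_div]
      rw [e3]
      exact abs_sub_le _ _ _
    have hK : 0 ≤ K := by positivity
    have e4 := mul_le_mul_of_nonneg_left e2 hK
    simp only [e1]
    have e5 : √(4 + σ ^ 2) * (|(∑ i : Fin m, x (some i, none) ^ 2) / n - α| / √α) =
      K * |(∑ i : Fin m, x (some i, none) ^ 2) / n - α| := by simp only [K]; ring
    have e6 : K * (d x / n + |(m : ℝ) / n - α|) = K * |(m : ℝ) / n - α| + K / n * d x := by ring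
    rw [e5]
    linarith
  have i1 : Integrable (fun x => b - K * |(m : ℝ) / n - α| - K / n * d x) μ :=
    (integrable_const _).sub (hd.const_mul _)
  have i2 : Integrable (fun x => 2 * ∑ t ∈ T, f t x / n) μ :=
    (integrable_finsetSum _ fun t _ => (hf t).div_const _).const_mul _
  have i12 : Integrable (fun x => b - K * |(m : ℝ) / n - α| - K / n * d x -
      2 * ∑ t ∈ T, f t x / n) μ := i1.sub i2
  have i3 : Integrable (fun x => 1 / √n * (σ * x (none, some none))) μ :=
    ((hI _).const_mul _).const_mul _
  refine le_trans ?_ (integral_mono (i12.add i3) ?_ hpt)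
  · have h3 : ∫ x, 1 / √n * (σ * x (none, some none)) ∂μ = 0 := by
      rw [integral_const_mul, integral_const_mul,
        integral_comp_eval (μ := fun _ : Option (Fin m) × Option (Option (Fin n)) =>
          gaussianReal 0 1) (f := fun y : ℝ => y) aestronglyMeasurable_id]
      simp [integral_id_gaussianReal]
    simp only [Pi.add_apply]
    rw [integral_add i12 i3, h3, integral_sub i1 i2, integral_sub (integrable_const _)
      (hd.const_mul _), integral_const_mul, integral_const_mul, integral_finsetSum _
      fun t _ => (hf t).div_const _]
    simp only [integral_div, integral_const, probReal_univ, smul_eq_mul, one_mul]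
    have hK : 0 ≤ K / n := by positivity
    have e1 := mul_le_mul_of_nonneg_left hd' hK
    have e2 : ∑ t ∈ T, (∫ x, f t x ∂μ) / n ≤
        ∑ t ∈ T, √(n * Var[fun x => max (t - x) 0; gaussianReal 0 1]) / n :=
      Finset.sum_le_sum fun t _ => div_le_div_of_nonneg_right (hf' t) hn0.le
    have e3 : K * (√(m * Var[fun x => x ^ 2; gaussianReal 0 1]) / n + |(m : ℝ) / n - α|) =
      K / n * √(m * Var[fun x => x ^ 2; gaussianReal 0 1]) + K * |(m : ℝ) / n - α| := by ring
    rw [e3]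
    linarith
  · refine Integrable.const_mul (integrable_ciInf fun w => ?_) _
    exact ((integrable_sqrt_sum_sq fun i => hI _).const_mul _).add
      (integrable_finsetSum _ fun l _ => (hI _).const_mul _)

lemma mlValue_le {n : ℕ} (hn : 0 < n) (σ : ℝ) (m : ℕ) :
    1 / √n * mlValue σ m n ≤ (σ ^ 2 * (m / n) + 1) / 2 := by
  set I := Option (Fin m) × Option (Option (Fin n))
  have hI := fun i : I => integrable_eval_gaussPi (I := I) i
  have hi : ∀ i : I, Integrable (fun x : I → ℝ => x i ^ 2) (gaussPi I) := fun i =>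
    (memLp_comp_eval_gaussPi memLp_sq_gaussianReal i).integrable one_le_two
  have hE : ∀ i : I, ∫ x, x i ^ 2 ∂gaussPi I = 1 := by
    intro i
    rw [integral_comp_eval (μ := fun _ : I => gaussianReal 0 1) (f := fun y : ℝ => y ^ 2)
      (by fun_prop), integral_sq_gaussianReal]
  have hs : Integrable (fun x : I → ℝ => ∑ i : Fin m, x (some i, some none) ^ 2) (gaussPi I) :=
    integrable_finsetSum _ fun i _ => hi _
  have hsn : 0 < √(n : ℝ) := sqrt_pos.2 (by positivity)
  rw [mlValue, ← integral_const_mul]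
  have h : ∀ x : I → ℝ, 1 / √n * ⨅ w : Fin n → Bool,
      √(∑ i : Fin m, (∑ l, errorVec σ w l * x (some i, some l)) ^ 2) ≤
      σ ^ 2 / (2 * n) * (∑ i : Fin m, x (some i, some none) ^ 2) + 1 / 2 := by
    intro x
    have h1 := ciInf_le (Set.finite_range fun w : Fin n → Bool =>
      √(∑ i : Fin m, (∑ l, errorVec σ w l * x (some i, some l)) ^ 2)).bddBelow (fun _ => true)
    have h2 : ∀ i : Fin m, ∑ l, errorVec σ (fun _ : Fin n => true) l * x (some i, some l) =
        σ * x (some i, some none) := by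
      intro i
      simp [Fintype.sum_option, errorVec, cubePoint]
    simp only [h2, mul_pow, ← Finset.mul_sum] at h1
    set S := ∑ i : Fin m, x (some i, some none) ^ 2
    have hS : 0 ≤ S := Finset.sum_nonneg fun i _ => sq_nonneg _
    refine (mul_le_mul_of_nonneg_left h1 (by positivity)).trans ?_
    have h3 : 0 ≤ σ ^ 2 * S := by positivity
    have h4 : (1 / √n * √(σ ^ 2 * S)) ^ 2 = σ ^ 2 * S / n := by
      rw [mul_pow, one_div_sqrt_sq, sq_sqrt h3]; ring
    have h5 : σ ^ 2 / (2 * n) * S = σ ^ 2 * S / n / 2 := by ring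
    rw [h5, ← h4]
    nlinarith [sq_nonneg (1 / √n * √(σ ^ 2 * S) - 1)]
  refine (integral_mono (Integrable.const_mul (integrable_ciInf fun w => integrable_sqrt_sum_sq
    fun i => integrable_finsetSum _ fun l _ => (hI _).const_mul _) _)
    ((hs.const_mul _).add (integrable_const _)) h).trans (le_of_eq ?_)
  simp only [Pi.add_apply]
  rw [integral_add (hs.const_mul _) (integrable_const _), integral_const_mul,
    integral_finsetSum _ fun i _ => hi _]
  simp only [hE, Finset.sum_const, Finset.card_univ, Fintype.card_fin, integral_const,
    probReal_univ, smul_eq_mul, nsmul_eq_mul]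
  field_simp

lemma exists_finset_net (M : ℝ) {δ : ℝ} (hδ : 0 < δ) : ∃ T : Finset ℝ,
    (∀ τ ∈ Set.Icc (-M) M, ∃ t ∈ T, |t - τ| ≤ δ) ∧ M ∈ T ∧ -M ∈ T := by
  classical
  obtain ⟨s, -, hs, hcov⟩ := (isCompact_Icc (a := -M) (b := M)).finite_cover_balls hδ
  refine ⟨insert M (insert (-M) hs.toFinset), fun τ hτ => ?_, by simp, by simp⟩
  obtain ⟨t, ht, htτ⟩ := Set.mem_iUnion₂.1 (hcov hτ)
  refine ⟨t, by simp [ht], ?_⟩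
  rw [Metric.mem_ball, Real.dist_eq, abs_sub_comm] at htτ
  exact htτ.le

lemma exists_threshold_value {α σ : ℝ} {erfinv F : ℝ → ℝ}
    (herfinv : ∀ y : ℝ, -1 < y → y < 1 → erf (erfinv y) = y)
    (hF : ∀ c : ℝ, F c = if c = 1 ∨ c = -1 then √α * √(2 - 2 * c + σ ^ 2)
      else √α * √(2 - 2 * c + σ ^ 2) - √(2 / π) * rexp (-(erfinv c) ^ 2))
    {M δ : ℝ} (hM : 0 < M) (hδ : 0 ≤ δ) {T : Finset ℝ}
    (hT : ∀ τ ∈ Set.Icc (-M) M, ∃ t ∈ T, |t - τ| ≤ δ) (hTM : M ∈ T) (hTM' : -M ∈ T)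
    {c : ℝ} (hc : c ∈ Set.Icc (-1 : ℝ) 1) :
    ∃ t ∈ T, F c - (1 / (2 * M) + 4 * δ) ≤
      √α * √(2 - 2 * c + σ ^ 2) + ((1 - c) * t - 2 * hinge t) := by
  have h1 := hinge_neg_le hM
  have h2 := hinge_neg M
  have h3 : 1 / (2 * M) = 2 * (1 / (4 * M)) := by field_simp; norm_num
  rw [hF]
  split_ifs with h
  · rcases h with rfl | rfl
    · exact ⟨-M, hTM', by linarith⟩
    · exact ⟨M, hTM, by linarith⟩
  · push Not at h
    obtain ⟨t, ht, hle⟩ := exists_threshold hM hT hTM hTM' (erfinv c)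
    rw [herfinv c (lt_of_le_of_ne hc.1 h.2.symm) (lt_of_le_of_ne hc.2 h.1)] at hle
    exact ⟨t, ht, by linarith⟩

lemma bddBelow_range_dual {α σ : ℝ} {erfinv F : ℝ → ℝ}
    (hF : ∀ c : ℝ, F c = if c = 1 ∨ c = -1 then √α * √(2 - 2 * c + σ ^ 2)
      else √α * √(2 - 2 * c + σ ^ 2) - √(2 / π) * rexp (-(erfinv c) ^ 2)) :
    BddBelow (Set.range fun c : Set.Icc (-1 : ℝ) 1 => F c) := by
  refine ⟨-√(2 / π), ?_⟩
  rintro _ ⟨c, rfl⟩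
  have h1 : 0 ≤ √α * √(2 - 2 * (c : ℝ) + σ ^ 2) := by positivity
  have h2 : √(2 / π) * rexp (-(erfinv c) ^ 2) ≤ √(2 / π) :=
    mul_le_of_le_one_right (sqrt_nonneg _) (exp_le_one_iff.2 (by nlinarith [sq_nonneg (erfinv c)]))
  have h3 := sqrt_nonneg (2 / π)
  simp only [hF]
  split_ifs <;> linarith

lemma tendsto_sqrt_mul_div {a : ℕ → ℝ} {l : ℝ} (h : Tendsto (fun n => a n / n) atTop (nhds l))
    (v : ℝ) : Tendsto (fun n : ℕ => √(a n * v) / n) atTop (nhds 0) := by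
  have h1 : Tendsto (fun n : ℕ => √(a n / n * (v * (1 / n)))) atTop (nhds √(l * (v * 0))) :=
    (h.mul (tendsto_one_div_atTop_nhds_zero_nat.const_mul v)).sqrt
  rw [mul_zero, mul_zero, sqrt_zero] at h1
  refine h1.congr fun n => ?_
  have : a n / n * (v * (1 / n)) = a n * v / (n : ℝ) ^ 2 := by ring
  rw [this, sqrt_div' _ (by positivity), sqrt_sq n.cast_nonneg]

/-- the liminf of the normalized expected ML objective is lower bounded by
the minimum over `c1 ∈ [-1,1]` of the closed-form random dual value `F(c1)` (with the
exponential term interpreted as its limit `0` at `c1 = ±1`). -/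
theorem ml_rdt_lower_bound
    (α σ : ℝ) (hα : 0 < α) (hσ : 0 < σ)
    (erfinv : ℝ → ℝ) (herfinv : ∀ y : ℝ, -1 < y → y < 1 → erf (erfinv y) = y)
    (F : ℝ → ℝ)
    (hF : ∀ c1 : ℝ, F c1 =
      if c1 = 1 ∨ c1 = -1 then Real.sqrt α * Real.sqrt (2 - 2*c1 + σ^2)
      else Real.sqrt α * Real.sqrt (2 - 2*c1 + σ^2)
        - Real.sqrt (2/π) * Real.exp (-(erfinv c1)^2))
    (ξ : ℕ → ℝ)
    (hξ : ∀ n : ℕ, ξ n = (1 / Real.sqrt n) *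
      ∫ p : (Fin (Nat.ceil (α * n)) → Fin n → ℝ) × (Fin (Nat.ceil (α * n)) → ℝ),
        sInf ((fun x : Fin n → ℝ =>
          Real.sqrt (∑ i, (∑ j, p.1 i j * (1 / Real.sqrt n - x j) + σ * p.2 i)^2)) ''
          {x : Fin n → ℝ | ∀ i, x i = 1 / Real.sqrt n ∨ x i = -(1 / Real.sqrt n)})
        ∂((Measure.pi fun _ => Measure.pi fun _ => gaussianReal 0 1).prod
            (Measure.pi fun _ => gaussianReal 0 1))) :
    (⨅ c1 : Set.Icc (-1 : ℝ) 1, F c1.1) ≤ atTop.liminf ξ := by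
  have hξ' : ∀ n : ℕ, ξ n = 1 / √n * mlValue σ ⌈α * n⌉₊ n := fun n => by
    rw [hξ, integral_sInf_eq_mlValue]
  have hceil : Tendsto (fun n : ℕ => (⌈α * n⌉₊ : ℝ) / n) atTop (nhds α) :=
    (tendsto_nat_ceil_mul_div_atTop hα.le).comp tendsto_natCast_atTop_atTop
  have hbdd : IsCoboundedUnder (· ≥ ·) atTop ξ := by
    have hlim : Tendsto (fun n : ℕ => (σ ^ 2 * (⌈α * n⌉₊ / n) + 1) / 2) atTop
        (nhds ((σ ^ 2 * α + 1) / 2)) := ((hceil.const_mul _).add_const _).div_const _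
    refine IsBoundedUnder.isCoboundedUnder_ge (hlim.isBoundedUnder_le.mono_le ?_)
    filter_upwards [eventually_gt_atTop 0] with n hn
    exact (hξ' n).trans_le (mlValue_le hn σ _)
  refine le_of_forall_pos_le_add fun ε hε => ?_
  rw [← sub_le_iff_le_add]
  obtain ⟨T, hT, hTM, hTM'⟩ := exists_finset_net (5 / ε) (δ := ε / 10) (by positivity)
  set b := (⨅ c1 : Set.Icc (-1 : ℝ) 1, F c1.1) - ε / 2 with hb
  have hTb : ∀ c ∈ Set.Icc (-1 : ℝ) 1, ∃ t ∈ T,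
      b ≤ √α * √(2 - 2 * c + σ ^ 2) + ((1 - c) * t - 2 * hinge t) := by
    intro c hc
    obtain ⟨t, ht, hle⟩ := exists_threshold_value herfinv hF (M := 5 / ε) (by positivity)
      (δ := ε / 10) (by positivity) hT hTM hTM' hc
    refine ⟨t, ht, le_trans ?_ hle⟩
    have h1 := ciInf_le (bddBelow_range_dual hF) ⟨c, hc⟩
    have h2 : 1 / (2 * (5 / ε)) = ε / 10 := by field_simp; norm_num
    rw [h2, hb]
    linarith
  have herr : Tendsto (fun n : ℕ => b - √(4 + σ ^ 2) / √α *
      (√(⌈α * n⌉₊ * Var[fun x => x ^ 2; gaussianReal 0 1]) / n + |(⌈α * n⌉₊ : ℝ) / n - α|)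
      - 2 * ∑ t ∈ T, √(n * Var[fun x => max (t - x) 0; gaussianReal 0 1]) / n) atTop (nhds b) := by
    have h1 : Tendsto (fun n : ℕ => (n : ℝ) / n) atTop (nhds 1) :=
      tendsto_const_nhds.congr' <| by
        filter_upwards [eventually_ne_atTop 0] with n hn
        exact (div_self (Nat.cast_ne_zero.2 hn)).symm
    have h2 : Tendsto (fun n : ℕ => |(⌈α * n⌉₊ : ℝ) / n - α|) atTop (nhds 0) := by
      simpa using (hceil.sub_const α).abs
    have h3 : Tendsto (fun n : ℕ => ∑ t ∈ T,
        √(n * Var[fun x => max (t - x) 0; gaussianReal 0 1]) / n) atTop (nhds 0) := by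
      simpa using tendsto_finsetSum T fun t _ => tendsto_sqrt_mul_div h1
        Var[fun x => max (t - x) 0; gaussianReal 0 1]
    simpa using (((tendsto_sqrt_mul_div hceil Var[fun x => x ^ 2; gaussianReal 0 1]).add
      h2).const_mul (√(4 + σ ^ 2) / √α)).const_sub b |>.sub (h3.const_mul 2)
  refine le_liminf_of_le hbdd ?_
  filter_upwards [herr.eventually_const_lt (u := b - ε / 2) (by linarith), eventually_gt_atTop 0]
    with n hn hn0
  rw [hξ']
  have := mlValue_ge (m := ⌈α * n⌉₊) hn0 hα hTb
  linarith
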